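/- arXiv:1610.06521 — 4 statements merged into one kernel-verified Lean document; each statement's English description precedes it below -/
import Mathlib

section
/- If G is an n-vertex graph containing no K_r as a subgraph and no K_{s,t} as an induced subgraph, then e(G) ≤ n^{2-1/s}·4^s·((r+t)^{t/s} + (r+s) + 2(r+t)^{t(s+1)/s^2}(r+s)) + 2·4^s·n. -/
open SimpleGraph Finset

/-- `H` occurs in `G` as an induced subgraph. -/
def HasInducedCopy {α β : Type*} (H : SimpleGraph α) (G : SimpleGraph β) : Prop :=
  Nonempty (H ↪g G)

namespace InducedTuran

theorem isNIndepSet_insert {V : Type*} [DecidableEq V] {G : SimpleGraph V} {n : ℕ}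
    {S : Finset V} {v : V} (hS : G.IsNIndepSet n S) (hv : ∀ w ∈ S, w ≠ v ∧ ¬ G.Adj v w) :
    G.IsNIndepSet (n + 1) (insert v S) := by
  rw [← isNClique_compl] at hS ⊢
  exact hS.insert fun w hw ↦ by
    rw [compl_adj]
    exact ⟨(hv w hw).1.symm, (hv w hw).2⟩

/-- Two disjoint independent sets joined completely span an induced complete bipartite graph. -/
theorem hasInducedCopy_completeBipartiteGraph {V : Type*} {G : SimpleGraph V} {s t : ℕ}
    {S T : Finset V}
    (hS : G.IsNIndepSet s S) (hT : G.IsNIndepSet t T) (hST : ∀ u ∈ S, ∀ v ∈ T, G.Adj u v) :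
    HasInducedCopy (completeBipartiteGraph (Fin s) (Fin t)) G := by
  let e := S.equivFinOfCardEq hS.card_eq
  let f := T.equivFinOfCardEq hT.card_eq
  have hS' : ∀ u ∈ S, ∀ v ∈ S, ¬ G.Adj u v := fun u hu v hv h ↦ hS.isIndepSet hu hv h.ne h
  have hT' : ∀ u ∈ T, ∀ v ∈ T, ¬ G.Adj u v := fun u hu v hv h ↦ hT.isIndepSet hu hv h.ne h
  refine ⟨⟨⟨Sum.elim (fun i ↦ (e.symm i : V)) (fun i ↦ (f.symm i : V)), ?_⟩, ?_⟩⟩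
  · refine Function.Injective.sumElim (Subtype.val_injective.comp e.symm.injective)
      (Subtype.val_injective.comp f.symm.injective) fun i j ↦ ?_
    exact (hST _ (e.symm i).2 _ (f.symm j).2).ne
  · rintro (i | i) (j | j)
    · simpa using hS' _ (e.symm i).2 _ (e.symm j).2
    · simpa using hST _ (e.symm i).2 _ (f.symm j).2
    · simpa using (hST _ (e.symm j).2 _ (f.symm i).2).symm
    · simpa using hT' _ (f.symm i).2 _ (f.symm j).2

variable {V : Type*} [DecidableEq V] (G : SimpleGraph V) [DecidableRel G.Adj]

/-- The vertices of `W` distinct from `u` and not adjacent to `u`. -/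
def nonNbrs (W : Finset V) (u : V) : Finset V :=
  {w ∈ W | w ≠ u ∧ ¬ G.Adj u w}

/-- The number of ordered independent `j`-tuples of distinct vertices of `W`. -/
def numIndep : ℕ → Finset V → ℕ
  | 0, _ => 1
  | j + 1, W => ∑ u ∈ W, numIndep j (nonNbrs G W u)

variable {G}

/-- The Erdős–Szekeres form of Ramsey's theorem. -/
theorem exists_isNClique_or_isNIndepSet (a b : ℕ) (W : Finset V)
    (hW : (a + b).choose b ≤ #W) :
    (∃ S ⊆ W, G.IsNClique (a + 1) S) ∨ ∃ S ⊆ W, G.IsNIndepSet (b + 1) S := by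
  induction a generalizing b W with
  | zero =>
    obtain ⟨v, hv⟩ : W.Nonempty := card_pos.1 (lt_of_lt_of_le (by simp) hW)
    exact Or.inl ⟨{v}, by simpa using hv, by simp⟩
  | succ a iha =>
    induction b generalizing W with
    | zero =>
      obtain ⟨v, hv⟩ : W.Nonempty := card_pos.1 (lt_of_lt_of_le (by simp) hW)
      exact Or.inr ⟨{v}, by simpa using hv, by simp [isNIndepSet_iff]⟩
    | succ b ihb =>
      have hpos : 0 < (a + 1 + (b + 1)).choose (b + 1) := Nat.choose_pos (by omega)
      obtain ⟨v, hv⟩ : W.Nonempty := card_pos.1 (by omega)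
      have hpascal : (a + 1 + (b + 1)).choose (b + 1) =
          (a + 1 + b).choose b + (a + (b + 1)).choose (b + 1) := by
        rw [show a + 1 + (b + 1) = (a + 1 + b) + 1 by ring, Nat.choose_succ_succ]
        congr 2
        ring
      have hsplit := card_filter_add_card_filter_not (s := W.erase v) (fun w ↦ G.Adj v w)
      rw [card_erase_of_mem hv] at hsplit
      rcases le_or_gt ((a + (b + 1)).choose (b + 1)) (#{w ∈ W.erase v | G.Adj v w}) with h | h
      · rcases iha (b + 1) _ h with ⟨S, hSW, hS⟩ | ⟨S, hSW, hS⟩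
        · refine Or.inl ⟨insert v S, ?_, hS.insert fun w hw ↦ (mem_filter.1 (hSW hw)).2⟩
          exact insert_subset hv
            (hSW.trans ((filter_subset _ _).trans (erase_subset _ _)))
        · exact Or.inr ⟨S, hSW.trans ((filter_subset _ _).trans (erase_subset _ _)), hS⟩
      · rcases ihb {w ∈ W.erase v | ¬ G.Adj v w} (by omega) with ⟨S, hSW, hS⟩ | ⟨S, hSW, hS⟩
        · exact Or.inl ⟨S, hSW.trans ((filter_subset _ _).trans (erase_subset _ _)), hS⟩
        · refine Or.inr ⟨insert v S, ?_, isNIndepSet_insert hS fun w hw ↦ ?_⟩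
          · exact insert_subset hv
              (hSW.trans ((filter_subset _ _).trans (erase_subset _ _)))
          · have := mem_filter.1 (hSW hw)
            exact ⟨(mem_erase.1 this.1).1, this.2⟩

/-- In a `K_r`-free graph without induced `K_{s,t}`, independent `s`-sets have few common
neighbours. -/
theorem card_commonNbrs_lt {r s t : ℕ} (hK : G.CliqueFree (r + 1))
    (hind : ¬ HasInducedCopy (completeBipartiteGraph (Fin s) (Fin (t + 1))) G)
    {S Z : Finset V} (hS : G.IsNIndepSet s S) (hZ : ∀ u ∈ S, ∀ v ∈ Z, G.Adj u v) :
    #Z < (r + t).choose t := by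
  by_contra! h
  rcases exists_isNClique_or_isNIndepSet (G := G) r t Z h with ⟨T, -, hT⟩ | ⟨T, hTZ, hT⟩
  · exact hK T hT
  · exact hind (hasInducedCopy_completeBipartiteGraph hS hT fun u hu v hv ↦ hZ u hu v (hTZ hv))

/-- Double counting of the pairs formed by a vertex and an independent tuple of its neighbours. -/
theorem sum_numIndep_le [Fintype V] {s Q : ℕ}
    (hQ : ∀ S Z : Finset V, G.IsNIndepSet s S → (∀ u ∈ S, ∀ v ∈ Z, G.Adj u v) → #Z ≤ Q)
    (j : ℕ) {i : ℕ} (hij : i + j = s) {S W Z : Finset V} (hS : G.IsNIndepSet i S)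
    (hW : ∀ u ∈ S, ∀ w ∈ W, u ≠ w ∧ ¬ G.Adj w u) (hZ : ∀ u ∈ S, ∀ v ∈ Z, G.Adj u v) :
    ∑ v ∈ Z, numIndep G j {w ∈ W | G.Adj v w} ≤ Fintype.card V ^ j * Q := by
  induction j generalizing i S W Z with
  | zero =>
    obtain rfl : i = s := by simpa using hij
    simpa [numIndep] using hQ S Z hS hZ
  | succ j ih =>
    have hswap : ∑ v ∈ Z, numIndep G (j + 1) {w ∈ W | G.Adj v w} =
        ∑ w ∈ W, ∑ v ∈ Z with G.Adj w v,
          numIndep G j {x ∈ nonNbrs G W w | G.Adj v x} := by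
      simp only [numIndep]
      rw [sum_comm' (t' := W) (s' := fun w ↦ {v ∈ Z | G.Adj w v})]
      · refine sum_congr rfl fun w _ ↦ sum_congr rfl fun v _ ↦ ?_
        congr 1
        ext x
        simp only [nonNbrs, mem_filter]
        tauto
      · intro v w
        simp only [mem_filter, G.adj_comm v w]
        tauto
    rw [hswap, pow_succ, mul_right_comm, mul_comm _ (Fintype.card V)]
    calc _ ≤ ∑ w ∈ W, Fintype.card V ^ j * Q := by
          refine sum_le_sum fun w hw ↦ ih (i := i + 1) (by omega) (S := insert w S)
            (isNIndepSet_insert hS fun u hu ↦ hW u hu w hw) ?_ ?_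
          · intro u hu x hx
            simp only [nonNbrs, mem_filter] at hx
            rcases mem_insert.1 hu with rfl | hu
            · exact ⟨hx.2.1.symm, fun h ↦ hx.2.2 h.symm⟩
            · exact hW u hu x hx.1
          · intro u hu v hv
            rw [mem_filter] at hv
            rcases mem_insert.1 hu with rfl | hu
            · exact hv.2
            · exact hZ u hu v hv.1
      _ ≤ Fintype.card V * (Fintype.card V ^ j * Q) := by
          rw [sum_const, smul_eq_mul]
          exact Nat.mul_le_mul_right _ (card_le_univ W)

/-- Few vertices have `s` neighbours inside a given independent set. -/
theorem card_manyNbrs_le {s Q : ℕ}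
    (hQ : ∀ S Z : Finset V, G.IsNIndepSet s S → (∀ u ∈ S, ∀ v ∈ Z, G.Adj u v) → #Z ≤ Q)
    {I : Finset V} (hI : G.IsIndepSet (I : Set V)) (W : Finset V) :
    #{w ∈ W | s ≤ #{u ∈ I | G.Adj u w}} ≤ (#I).choose s * Q := by
  have hsub : {w ∈ W | s ≤ #{u ∈ I | G.Adj u w}} ⊆
      (powersetCard s I).biUnion fun S ↦ {w ∈ W | ∀ u ∈ S, G.Adj u w} := by
    intro w hw
    obtain ⟨hwW, hw⟩ := mem_filter.1 hw
    obtain ⟨S, hS, hcard⟩ := exists_subset_card_eq hw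
    exact mem_biUnion.2 ⟨S, mem_powersetCard.2 ⟨hS.trans (filter_subset _ _), hcard⟩,
      mem_filter.2 ⟨hwW, fun u hu ↦ (mem_filter.1 (hS hu)).2⟩⟩
  refine (card_le_card hsub).trans ?_
  rw [← card_powersetCard]
  refine card_biUnion_le_card_mul _ _ _ fun S hS ↦ ?_
  obtain ⟨hSI, hcard⟩ := mem_powersetCard.1 hS
  exact hQ S _ ⟨hI.mono (by simpa using hSI), hcard⟩ fun u hu v hv ↦ (mem_filter.1 hv).2 u hu

/-- An independent set of size `s + a` contains a vertex with many non-neighbours. -/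
theorem exists_card_le_nonNbrs {s a k Q : ℕ} (hs : 0 < s) (hk : s ≤ k * (a + 1))
    (hQ : ∀ S Z : Finset V, G.IsNIndepSet s S → (∀ u ∈ S, ∀ v ∈ Z, G.Adj u v) → #Z ≤ Q)
    {I W : Finset V} (hI : G.IsNIndepSet (s + a) I)
    (hW : 2 * (s + a + (s + a).choose s * Q) ≤ #W) :
    ∃ u ∈ I, #W ≤ 2 * (k + 1) * #(nonNbrs G W u) := by
  by_contra! hlt
  set B := I ∪ {w ∈ W | s ≤ #{u ∈ I | G.Adj u w}} with hB
  have hBcard : #B ≤ s + a + (s + a).choose s * Q := by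
    refine (card_union_le _ _).trans ?_
    have := card_manyNbrs_le hQ hI.isIndepSet W
    rw [hI.card_eq] at this ⊢
    omega
  have hlow : #(W \ B) * (a + 1) ≤ ∑ u ∈ I, #(nonNbrs G W u) := by
    have hdc : ∑ u ∈ I, #(nonNbrs G W u) = ∑ w ∈ W, #{u ∈ I | w ≠ u ∧ ¬ G.Adj u w} :=
      sum_card_bipartiteAbove_eq_sum_card_bipartiteBelow (fun u w ↦ w ≠ u ∧ ¬ G.Adj u w)
    rw [hdc, ← smul_eq_mul]
    refine (card_nsmul_le_sum _ _ _ fun w hw ↦ ?_).trans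
      (sum_le_sum_of_subset (sdiff_subset : W \ B ⊆ W))
    simp only [hB, mem_sdiff, mem_union, mem_filter, not_or, not_and, not_le] at hw
    obtain ⟨hwW, hwI, hws⟩ := hw
    have hsplit := card_filter_add_card_filter_not (s := I) (fun u ↦ G.Adj u w)
    have heq : {u ∈ I | w ≠ u ∧ ¬ G.Adj u w} = {u ∈ I | ¬ G.Adj u w} :=
      filter_congr fun u hu ↦ ⟨fun h ↦ h.2, fun h ↦ ⟨fun h' ↦ hwI (h' ▸ hu), h⟩⟩
    have := hws hwW
    rw [hI.card_eq] at hsplit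
    rw [heq]
    omega
  have hne : I.Nonempty := card_pos.1 (by rw [hI.card_eq]; omega)
  have hup : ∑ u ∈ I, 2 * (k + 1) * #(nonNbrs G W u) < (s + a) * #W := by
    rw [← hI.card_eq, ← smul_eq_mul (#I), ← sum_const]
    exact sum_lt_sum_of_nonempty hne hlt
  rw [← mul_sum] at hup
  have hdiff : #W ≤ 2 * #(W \ B) := by
    have := le_card_sdiff B W
    omega
  have h1 : (s + a) * #W ≤ ((k + 1) * (a + 1)) * (2 * #(W \ B)) := by
    gcongr
    nlinarith
  have h2 : 2 * (k + 1) * (#(W \ B) * (a + 1)) ≤ 2 * (k + 1) * ∑ u ∈ I, #(nonNbrs G W u) := by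
    gcongr
  nlinarith

/-- In a large set, at least half of the vertices have many non-neighbours. -/
theorem card_le_two_mul_card_nonNbrs {r s a k Q : ℕ} (hK : G.CliqueFree (r + 1))
    (hs : 0 < s) (hk : s ≤ k * (a + 1))
    (hQ : ∀ S Z : Finset V, G.IsNIndepSet s S → (∀ u ∈ S, ∀ v ∈ Z, G.Adj u v) → #Z ≤ Q)
    {W : Finset V} (hW : 2 * (s + a + (s + a).choose s * Q) ≤ #W)
    (hR : 2 * (r + (s + a - 1)).choose (s + a - 1) ≤ #W) :
    #W ≤ 2 * #{u ∈ W | #W ≤ 2 * (k + 1) * #(nonNbrs G W u)} := by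
  by_contra! h
  have hsplit := card_filter_add_card_filter_not (s := W)
    (fun u ↦ #W ≤ 2 * (k + 1) * #(nonNbrs G W u))
  rcases exists_isNClique_or_isNIndepSet (G := G) r (s + a - 1)
    {u ∈ W | ¬ #W ≤ 2 * (k + 1) * #(nonNbrs G W u)} (by omega) with ⟨S, -, hS⟩ | ⟨I, hIW, hI⟩
  · exact hK S hS
  · rw [show s + a - 1 + 1 = s + a by omega] at hI
    obtain ⟨u, hu, hle⟩ := exists_card_le_nonNbrs hs hk hQ hI hW
    exact (mem_filter.1 (hIW hu)).2 hle

/-- If large sets contain many vertices with many non-neighbours, then they contain many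
independent tuples. -/
theorem card_pow_le_numIndep {c T : ℕ} (hc : 0 < c)
    (hstep : ∀ W : Finset V, T ≤ #W → #W ≤ 2 * #{u ∈ W | #W ≤ c * #(nonNbrs G W u)})
    (j : ℕ) {W : Finset V} (hW : c ^ j * T ≤ #W) :
    #W ^ (j + 1) ≤ 2 ^ j * c ^ (j * (j + 1)) * numIndep G (j + 1) W := by
  induction j generalizing W with
  | zero => simp [numIndep]
  | succ j ih =>
    have hT : T ≤ #W := (Nat.le_mul_of_pos_left T (by positivity)).trans hW
    set A := {u ∈ W | #W ≤ c * #(nonNbrs G W u)} with hA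
    have hterm : ∀ u ∈ A, #W ^ (j + 1) ≤
        2 ^ j * c ^ ((j + 1) * (j + 2)) * numIndep G (j + 1) (nonNbrs G W u) := by
      intro u hu
      have hu := (mem_filter.1 hu).2
      have hbig : c ^ j * T ≤ #(nonNbrs G W u) := by
        refine Nat.le_of_mul_le_mul_left (le_trans ?_ hu) hc
        rwa [← mul_assoc, ← pow_succ']
      calc #W ^ (j + 1) ≤ (c * #(nonNbrs G W u)) ^ (j + 1) := by gcongr
        _ = c ^ (j + 1) * #(nonNbrs G W u) ^ (j + 1) := mul_pow _ _ _
        _ ≤ c ^ (j + 1) *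
            (2 ^ j * c ^ (j * (j + 1)) * numIndep G (j + 1) (nonNbrs G W u)) := by
          gcongr
          exact ih hbig
        _ = 2 ^ j * c ^ (j * (j + 1) + (j + 1)) * numIndep G (j + 1) (nonNbrs G W u) := by
          ring
        _ ≤ _ := by
          gcongr
          nlinarith
    calc #W ^ (j + 1 + 1) = #W * #W ^ (j + 1) := pow_succ' _ _
      _ ≤ 2 * #A * #W ^ (j + 1) := by
        gcongr
        exact hstep W hT
      _ = 2 * ∑ u ∈ A, #W ^ (j + 1) := by
        rw [sum_const, smul_eq_mul, mul_assoc]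
      _ ≤ 2 * ∑ u ∈ A,
          2 ^ j * c ^ ((j + 1) * (j + 2)) * numIndep G (j + 1) (nonNbrs G W u) := by
        gcongr with u hu
        exact hterm u hu
      _ ≤ 2 * ∑ u ∈ W,
          2 ^ j * c ^ ((j + 1) * (j + 2)) * numIndep G (j + 1) (nonNbrs G W u) := by
        gcongr
        exact filter_subset _ _
      _ = _ := by
        rw [← mul_sum, numIndep]
        ring

/-- If independent `s`-sets have few common neighbours and large sets contain many vertices with
many non-neighbours, then the graph has few edges. -/
theorem card_edgeFinset_pow_le [Fintype V] {j c T Q : ℕ} (hc : 0 < c)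
    (hQ : ∀ S Z : Finset V, G.IsNIndepSet (j + 1) S →
      (∀ u ∈ S, ∀ v ∈ Z, G.Adj u v) → #Z ≤ Q)
    (hstep : ∀ W : Finset V, T ≤ #W → #W ≤ 2 * #{u ∈ W | #W ≤ c * #(nonNbrs G W u)})
    (hE : c ^ j * T * Fintype.card V ≤ #G.edgeFinset) :
    #G.edgeFinset ^ (j + 1) ≤
      2 ^ j * c ^ (j * (j + 1)) * Q * Fintype.card V ^ (2 * j + 1) := by
  set H : Finset V := {v | c ^ j * T ≤ G.degree v}
  have hhigh : #G.edgeFinset ≤ ∑ v ∈ H, G.degree v := by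
    have hsum := G.sum_degrees_eq_twice_card_edges
    rw [← sum_filter_add_sum_filter_not univ (fun v ↦ c ^ j * T ≤ G.degree v)] at hsum
    have hlow : ∑ v with ¬ c ^ j * T ≤ G.degree v, G.degree v ≤ #G.edgeFinset := by
      calc _ ≤ ∑ v with ¬ c ^ j * T ≤ G.degree v, c ^ j * T :=
            sum_le_sum fun v hv ↦ (not_le.1 (mem_filter.1 hv).2).le
        _ ≤ Fintype.card V * (c ^ j * T) := by
            rw [sum_const, smul_eq_mul]
            exact Nat.mul_le_mul_right _ (card_le_univ _)
        _ ≤ _ := by rwa [mul_comm]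
    change #G.edgeFinset ≤ ∑ v with c ^ j * T ≤ G.degree v, G.degree v
    omega
  have hmean : (∑ v ∈ H, G.degree v) ^ (j + 1) ≤ #H ^ j * ∑ v ∈ H, G.degree v ^ (j + 1) := by
    rcases H.eq_empty_or_nonempty with hH | hH
    · simp [hH]
    have h := pow_sum_div_card_le_sum_pow (s := H) (f := fun v ↦ (G.degree v : ℝ))
      (fun _ _ ↦ Nat.cast_nonneg _) j
    have hpos : (0 : ℝ) < (#H : ℝ) ^ j := by
      have := card_pos.2 hH
      positivity
    rw [div_le_iff₀' hpos] at h
    exact_mod_cast h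
  have hcount : ∑ v ∈ H, G.degree v ^ (j + 1) ≤
      2 ^ j * c ^ (j * (j + 1)) * (Fintype.card V ^ (j + 1) * Q) := by
    calc _ ≤ ∑ v ∈ H, 2 ^ j * c ^ (j * (j + 1)) *
            numIndep G (j + 1) {w ∈ (univ : Finset V) | G.Adj v w} := by
          refine sum_le_sum fun v hv ↦ ?_
          rw [← G.card_neighborFinset_eq_degree, ← G.neighborFinset_eq_filter]
          refine card_pow_le_numIndep hc hstep j ?_
          rw [G.card_neighborFinset_eq_degree]
          exact (mem_filter.1 hv).2
      _ ≤ _ := by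
          rw [← mul_sum]
          gcongr
          exact sum_numIndep_le hQ (j + 1) (i := 0) (S := ∅) (by omega)
            (by simp [isNIndepSet_iff]) (by simp) (by simp)
  calc #G.edgeFinset ^ (j + 1) ≤ (∑ v ∈ H, G.degree v) ^ (j + 1) := by gcongr
    _ ≤ #H ^ j * ∑ v ∈ H, G.degree v ^ (j + 1) := hmean
    _ ≤ Fintype.card V ^ j *
        (2 ^ j * c ^ (j * (j + 1)) * (Fintype.card V ^ (j + 1) * Q)) := by
      gcongr
      exact card_le_univ H
    _ = _ := by ring

theorem choose_add_le_pow_mul (p q a Y : ℕ) (hY : p + q + 2 ≤ (q + 1) * Y) :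
    (p + (q + a)).choose (q + a) ≤ (p + q).choose q * Y ^ a := by
  induction a with
  | zero => simp
  | succ a ih =>
    have h := Nat.add_one_mul_choose_eq (p + (q + a)) (q + a)
    have hpos : 0 < q + a + 1 := by omega
    refine Nat.le_of_mul_le_mul_right ?_ hpos
    calc (p + (q + (a + 1))).choose (q + (a + 1)) * (q + a + 1)
        = (p + (q + a) + 1) * (p + (q + a)).choose (q + a) := h.symm
      _ ≤ ((q + a + 1) * Y) * ((p + q).choose q * Y ^ a) := by
        gcongr
        have : 1 ≤ Y := by
          by_contra! h0
          interval_cases Y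
          omega
        nlinarith
      _ = _ := by ring

/-- The choice of the parameters `a` and `k` in terms of `r = p + 1` and `s = j + 1`. -/
theorem exists_parameters (p j : ℕ) : ∃ a k : ℕ, j + 1 ≤ k * (a + 1) ∧ a ≤ j + 1 ∧
    (2 * (k + 1)) ^ j ≤ 4 ^ j * (p + j + 2) ∧
    (p + (j + a)).choose (j + a) ≤ (p + j + 2) ^ j * 2 ^ ((j + 1) * (j + 1)) := by
  set l := Nat.log (2 ^ (j + 1)) ((p + j + 2) / (j + 1))
  have hb : 1 < 2 ^ (j + 1) := Nat.one_lt_two_pow (by omega)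
  have hx : (p + j + 2) / (j + 1) ≠ 0 := by
    have := Nat.div_pos (show j + 1 ≤ p + j + 2 by omega) (by omega)
    omega
  have hlow : (2 ^ (j + 1)) ^ l ≤ p + j + 2 :=
    (Nat.pow_log_le_self _ hx).trans (Nat.div_le_self _ _)
  have hup : p + j + 2 < (j + 1) * (2 ^ (j + 1)) ^ (l + 1) := by
    have := Nat.lt_pow_succ_log_self hb ((p + j + 2) / (j + 1))
    rw [Nat.div_lt_iff_lt_mul (by omega), mul_comm] at this
    exact this
  refine ⟨(j + 1) / (l + 1), l + 1, ?_, Nat.div_le_self _ _, ?_, ?_⟩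
  · exact (Nat.lt_mul_div_succ (j + 1) (by omega : 0 < l + 1)).le
  · have hl2 : l + 2 ≤ 2 * 2 ^ l := by
      have := Nat.lt_two_pow_self (n := l)
      omega
    calc (2 * (l + 1 + 1)) ^ j ≤ (2 * (2 * 2 ^ l)) ^ j := by gcongr
      _ = 4 ^ j * (2 ^ j) ^ l := by
        rw [← mul_assoc, mul_pow, ← pow_mul, ← pow_mul, mul_comm l j]
        norm_num
      _ ≤ 4 ^ j * (2 ^ (j + 1)) ^ l := by gcongr <;> omega
      _ ≤ _ := by gcongr
  · refine (choose_add_le_pow_mul p j _ _ hup.le).trans ?_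
    have h1 : (p + j).choose j ≤ (p + j + 2) ^ j :=
      (Nat.choose_le_pow _ _).trans (Nat.pow_le_pow_left (by omega) _)
    have h2 : ((2 ^ (j + 1)) ^ (l + 1)) ^ ((j + 1) / (l + 1)) ≤ 2 ^ ((j + 1) * (j + 1)) := by
      rw [← pow_mul, ← pow_mul]
      gcongr
      · norm_num
      · exact Nat.mul_div_le _ _
    gcongr

theorem choose_add_le_pow (p q : ℕ) : (p + q).choose q ≤ (p + q + 2) ^ q :=
  (Nat.choose_le_pow _ _).trans (Nat.pow_le_pow_left (by omega) _)

theorem card_edgeFinset_pow_le_of_not_hasInducedCopy [Fintype V] {p j q : ℕ}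
    (hK : G.CliqueFree (p + 1))
    (hind : ¬ HasInducedCopy (completeBipartiteGraph (Fin (j + 1)) (Fin (q + 1))) G) :
    #G.edgeFinset ^ (j + 1) ≤ 2 ^ (j + 1) * 4 ^ ((j + 1) * (j + 1)) *
      (p + q + 2) ^ (q + 1) * (p + j + 2) ^ (j + 1) * Fintype.card V ^ (2 * j + 1) := by
  obtain ⟨a, k, hk, ha, hc, hR⟩ := exists_parameters p j
  set n := Fintype.card V
  set E := #G.edgeFinset
  set Q := (p + q + 2) ^ (q + 1)
  set M := 2 ^ (j + 1) * 4 ^ ((j + 1) * (j + 1)) * Q * (p + j + 2) ^ (j + 1) with hM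
  set c := 2 * (k + 1)
  set R := (p + (j + a)).choose (j + a)
  by_contra! hlt
  have hQ2 : 2 ≤ Q := by
    calc 2 ≤ p + q + 2 := by omega
      _ ≤ Q := Nat.le_self_pow (by omega) _
  have hQ : ∀ S Z : Finset V, G.IsNIndepSet (j + 1) S →
      (∀ u ∈ S, ∀ v ∈ Z, G.Adj u v) → #Z ≤ Q - 1 := by
    intro S Z hS hZ
    have h := card_commonNbrs_lt hK hind hS hZ
    have : (p + q).choose q ≤ Q :=
      (choose_add_le_pow p q).trans (Nat.pow_le_pow_right (by omega) (by omega))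
    omega
  have hX : j + 1 + a + (j + 1 + a).choose (j + 1) * (Q - 1) ≤ 4 ^ (j + 1) * Q := by
    have h4 : 2 ^ (2 * (j + 1)) = 4 ^ (j + 1) := by
      rw [pow_mul]
      norm_num
    have h1 : j + 1 + a ≤ 4 ^ (j + 1) := by
      have := Nat.lt_two_pow_self (n := 2 * (j + 1))
      omega
    have h2 : (j + 1 + a).choose (j + 1) ≤ 4 ^ (j + 1) := by
      rw [← h4]
      exact (Nat.choose_le_two_pow _ _).trans
        (Nat.pow_le_pow_right (by omega) (by omega))
    calc _ ≤ 4 ^ (j + 1) + 4 ^ (j + 1) * (Q - 1) := by gcongr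
      _ = 4 ^ (j + 1) * (1 + (Q - 1)) := by ring
      _ = _ := by congr 1; omega
  have hstep : ∀ W : Finset V, max (2 * R) (2 * (4 ^ (j + 1) * Q)) ≤ #W →
      #W ≤ 2 * #{u ∈ W | #W ≤ c * #(nonNbrs G W u)} := by
    intro W hW
    have hWR := (le_max_left _ _).trans hW
    have hWX := (le_max_right _ _).trans hW
    refine card_le_two_mul_card_nonNbrs hK (by omega) hk hQ ?_ ?_
    · exact (Nat.mul_le_mul_left 2 hX).trans hWX
    · rwa [show j + 1 + a - 1 = j + a by omega]
  have hthreshold : c ^ j * max (2 * R) (2 * (4 ^ (j + 1) * Q)) ≤ 2 ^ j * M := by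
    have hpow : 1 ≤ (p + j + 2) ^ j := Nat.one_le_pow _ _ (by omega)
    rw [← Nat.mul_max_mul_left]
    refine max_le ?_ ?_
    · calc c ^ j * (2 * R)
          ≤ 4 ^ j * (p + j + 2) * (2 * ((p + j + 2) ^ j * 2 ^ ((j + 1) * (j + 1)))) := by gcongr
        _ = 2 * 2 ^ j * 2 ^ j * 2 ^ ((j + 1) * (j + 1)) * 1 * (p + j + 2) ^ (j + 1) := by
          rw [show 4 = 2 * 2 by norm_num, mul_pow]
          ring
        _ ≤ 2 * 2 ^ j * 2 ^ j * 4 ^ ((j + 1) * (j + 1)) * Q * (p + j + 2) ^ (j + 1) := by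
          gcongr <;> omega
        _ = 2 ^ j * M := by rw [hM]; ring
    · calc c ^ j * (2 * (4 ^ (j + 1) * Q))
          ≤ 4 ^ j * (p + j + 2) * (2 * (4 ^ (j + 1) * Q)) := by gcongr
        _ = 2 * 2 ^ j * 2 ^ j * 4 ^ (j + 1) * Q * ((p + j + 2) * 1) := by
          rw [show 4 ^ j = 2 ^ j * 2 ^ j by rw [← mul_pow]; norm_num]
          ring
        _ ≤ 2 * 2 ^ j * 2 ^ j * 4 ^ ((j + 1) * (j + 1)) * Q *
            ((p + j + 2) * (p + j + 2) ^ j) := by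
          gcongr
          · norm_num
          · nlinarith
        _ = 2 ^ j * M := by rw [hM]; ring
  have hnE : 2 * E ≤ n ^ 2 := by
    have h : E ≤ n.choose 2 := G.card_edgeFinset_le_card_choose_two
    have h' := Nat.choose_two_right n
    have h3 : n * (n - 1) ≤ n ^ 2 := by
      rw [sq]
      exact Nat.mul_le_mul_left _ (Nat.sub_le _ _)
    omega
  have hE : 2 ^ j * M * n ≤ E := by
    by_contra! hlt'
    have : E ^ (j + 1) ≤ M * n ^ (2 * j + 1) := by
      calc E ^ (j + 1) = E * E ^ j := pow_succ' _ _
        _ ≤ (2 ^ j * M * n) * E ^ j := by gcongr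
        _ = M * n * (2 * E) ^ j := by ring
        _ ≤ M * n * (n ^ 2) ^ j := by gcongr
        _ = _ := by ring
    omega
  have hmain := card_edgeFinset_pow_le (c := c) (by omega) hQ hstep
    (le_trans (Nat.mul_le_mul_right n hthreshold) hE)
  have hcoef : 2 ^ j * c ^ (j * (j + 1)) * (Q - 1) ≤ M := by
    calc _ ≤ 2 ^ (j + 1) * (4 ^ (j + 1) * (p + j + 2)) ^ (j + 1) * Q := by
          rw [pow_mul]
          gcongr
          · norm_num
          · omega
          · refine hc.trans ?_
            gcongr <;> omega
          · omega
      _ = M := by rw [hM, mul_pow, ← pow_mul]; ring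
  exact hlt.not_ge (hmain.trans (Nat.mul_le_mul_right _ hcoef))

end InducedTuran

open InducedTuran

/-- **Theorem 1.** If `G` is an `n`-vertex graph with no `K_r` subgraph and no induced
`K_{s,t}`, then
`e(G) ≤ n^{2-1/s}·4^s·((r+t)^{t/s} + (r+s) + 2(r+t)^{t(s+1)/s²}(r+s)) + 2·4^s·n`. -/
theorem stmt1 (r s t n : ℕ) (hr : 0 < r) (hs : 0 < s) (ht : 0 < t)
    (G : SimpleGraph (Fin n)) [DecidableRel G.Adj]
    (hKr : G.CliqueFree r)
    (hind : ¬ HasInducedCopy (completeBipartiteGraph (Fin s) (Fin t)) G) :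
    (G.edgeFinset.card : ℝ) ≤
      (n : ℝ) ^ ((2 : ℝ) - 1 / s) * 4 ^ s *
        ((r + t : ℝ) ^ ((t : ℝ) / s) + (r + s : ℝ) +
          2 * (r + t : ℝ) ^ ((t : ℝ) * (s + 1) / (s : ℝ) ^ 2) * (r + s : ℝ)) +
      2 * 4 ^ s * n := by
  have hnat : #G.edgeFinset ^ s ≤
      2 ^ s * 4 ^ (s * s) * (r + t) ^ t * (r + s) ^ s * n ^ (2 * s - 1) := by
    obtain ⟨p, rfl⟩ := Nat.exists_eq_add_one_of_ne_zero hr.ne'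
    obtain ⟨j, rfl⟩ := Nat.exists_eq_add_one_of_ne_zero hs.ne'
    obtain ⟨q, rfl⟩ := Nat.exists_eq_add_one_of_ne_zero ht.ne'
    have h := card_edgeFinset_pow_le_of_not_hasInducedCopy hKr hind
    rw [Fintype.card_fin] at h
    rwa [show p + 1 + (q + 1) = p + q + 2 by ring, show p + 1 + (j + 1) = p + j + 2 by ring,
      show 2 * (j + 1) - 1 = 2 * j + 1 by omega]
  have hs0 : (s : ℝ) ≠ 0 := by positivity
  have hreal : (#G.edgeFinset : ℝ) ≤
      2 * 4 ^ s * (r + t : ℝ) ^ ((t : ℝ) / s) * (r + s) * (n : ℝ) ^ ((2 : ℝ) - 1 / s) := by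
    refine le_of_pow_le_pow_left₀ hs.ne' (by positivity) ?_
    have hQ : ((r + t : ℝ) ^ ((t : ℝ) / s)) ^ s = (r + t : ℝ) ^ t := by
      rw [← Real.rpow_natCast, ← Real.rpow_mul (by positivity), div_mul_cancel₀ _ hs0,
        Real.rpow_natCast]
    have hn : ((n : ℝ) ^ ((2 : ℝ) - 1 / s)) ^ s = (n : ℝ) ^ (2 * s - 1) := by
      rw [← Real.rpow_natCast, ← Real.rpow_mul (by positivity), ← Real.rpow_natCast]
      congr 1
      rw [Nat.cast_sub (by omega)]
      push_cast
      field_simp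
    rw [mul_pow, mul_pow, mul_pow, mul_pow, hQ, hn, ← pow_mul]
    exact_mod_cast hnat
  have hexp : (r + t : ℝ) ^ ((t : ℝ) / s) ≤
      (r + t : ℝ) ^ ((t : ℝ) * (s + 1) / (s : ℝ) ^ 2) := by
    refine Real.rpow_le_rpow_of_exponent_le ?_ ?_
    · exact_mod_cast (by omega : 1 ≤ r + t)
    · rw [div_le_div_iff₀ (by positivity) (by positivity)]
      have : (0 : ℝ) ≤ (t : ℝ) * s := by positivity
      nlinarith
  calc (#G.edgeFinset : ℝ)
      ≤ 2 * 4 ^ s * (r + t : ℝ) ^ ((t : ℝ) / s) * (r + s) * (n : ℝ) ^ ((2 : ℝ) - 1 / s) := hreal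
    _ ≤ 2 * 4 ^ s * (r + t : ℝ) ^ ((t : ℝ) * (s + 1) / (s : ℝ) ^ 2) * (r + s) *
        (n : ℝ) ^ ((2 : ℝ) - 1 / s) := by gcongr
    _ = (n : ℝ) ^ ((2 : ℝ) - 1 / s) * 4 ^ s *
        (0 + 2 * (r + t : ℝ) ^ ((t : ℝ) * (s + 1) / (s : ℝ) ^ 2) * (r + s : ℝ)) + 0 := by ring
    _ ≤ _ := by
      gcongr <;> positivity
end

section
/- For every t ≥ 2 and every non-bipartite graph H, the maximum number of edges of an n-vertex graph with no subgraph H and no induced K_{2,t+1} is at least (1/4)√t · n^{3/2} − o(n^{3/2}). -/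
open SimpleGraph Finset

/-- `H` occurs in `G` as a (not necessarily induced) subgraph. -/
def HasCopy {α β : Type*} (H : SimpleGraph α) (G : SimpleGraph β) : Prop :=
  ∃ f : α → β, Function.Injective f ∧ ∀ a b, H.Adj a b → G.Adj (f a) (f b)

section PrimePowers

open MeasureTheory Filter Topology ArithmeticFunction vonMangoldt
open scoped FourierTransform

/-- The Fourier transform of a minorant of the indicator function of `[-1, 1]`. -/
noncomputable def minorantFourier (ξ : ℝ) : ℝ :=
  max (1 - |ξ|) 0 + if |ξ| ≤ 1 then Real.sin (2 * Real.pi * |ξ|) / (2 * Real.pi) else 0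

/-- A continuous integrable function with integral `1`, nonpositive outside `[-1, 1]`, whose
Fourier transform has compact support. -/
noncomputable def minorant (u : ℝ) : ℝ :=
  ∫ ξ, minorantFourier ξ * Real.cos (2 * Real.pi * u * ξ)

lemma continuous_minorantFourier : Continuous minorantFourier := by
  unfold minorantFourier
  refine Continuous.add (by fun_prop) (Continuous.if_le (by fun_prop) continuous_const
    (by fun_prop) continuous_const ?_)
  intro x hx
  simp [hx]

lemma minorantFourier_eq_zero {ξ : ℝ} (h : ξ ∉ Set.Icc (-1 : ℝ) 1) :
    minorantFourier ξ = 0 := by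
  have : 1 < |ξ| := by
    by_contra! h'
    exact h (abs_le.mp h')
  simp [minorantFourier, this.not_ge, this.le]

lemma minorantFourier_of_mem_Icc {ξ : ℝ} (h₀ : 0 ≤ ξ) (h₁ : ξ ≤ 1) :
    minorantFourier ξ = 1 - ξ + Real.sin (2 * Real.pi * ξ) / (2 * Real.pi) := by
  simp [minorantFourier, abs_of_nonneg h₀, h₁]

lemma minorantFourier_neg (ξ : ℝ) : minorantFourier (-ξ) = minorantFourier ξ := by
  simp [minorantFourier]

lemma hasCompactSupport_minorantFourier : HasCompactSupport minorantFourier :=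
  HasCompactSupport.intro isCompact_Icc fun _ ↦ minorantFourier_eq_zero

lemma integrable_minorantFourier : Integrable minorantFourier :=
  continuous_minorantFourier.integrable_of_hasCompactSupport hasCompactSupport_minorantFourier

lemma integrable_minorantFourier_mul {f : ℝ → ℂ} (hf : Continuous f) :
    Integrable fun ξ ↦ (minorantFourier ξ : ℂ) * f ξ := by
  refine Continuous.integrable_of_hasCompactSupport
    ((Complex.continuous_ofReal.comp continuous_minorantFourier).mul hf) ?_
  exact HasCompactSupport.intro isCompact_Icc (K := Set.Icc (-1 : ℝ) 1) fun ξ h ↦ by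
    simp [minorantFourier_eq_zero h]

lemma integral_minorantFourier_mul_cexp (u : ℝ) :
    ∫ ξ : ℝ, (minorantFourier ξ : ℂ) * Complex.exp (-(2 * Real.pi * u * ξ : ℝ) * Complex.I) =
      minorant u := by
  have hodd : ∫ ξ : ℝ, minorantFourier ξ * Real.sin (2 * Real.pi * u * ξ) = 0 := by
    have h := integral_neg_eq_self
      (fun ξ : ℝ ↦ minorantFourier ξ * Real.sin (2 * Real.pi * u * ξ)) volume
    simp only [minorantFourier_neg, mul_neg, Real.sin_neg, integral_neg] at h
    linarith
  have h₁ : Integrable fun ξ : ℝ ↦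
      ((minorantFourier ξ * Real.cos (2 * Real.pi * u * ξ) : ℝ) : ℂ) := by
    simp only [Complex.ofReal_mul]
    exact integrable_minorantFourier_mul (by fun_prop)
  have h₂ : Integrable fun ξ : ℝ ↦
      ((minorantFourier ξ * Real.sin (2 * Real.pi * u * ξ) : ℝ) : ℂ) := by
    simp only [Complex.ofReal_mul]
    exact integrable_minorantFourier_mul (by fun_prop)
  calc
    _ = ∫ ξ : ℝ, (((minorantFourier ξ * Real.cos (2 * Real.pi * u * ξ) : ℝ) : ℂ) -
          ((minorantFourier ξ * Real.sin (2 * Real.pi * u * ξ) : ℝ) : ℂ) * Complex.I) := by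
      congr with ξ
      rw [Complex.exp_mul_I, ← Complex.ofReal_neg, ← Complex.ofReal_cos, ← Complex.ofReal_sin,
        Real.cos_neg, Real.sin_neg]
      push_cast
      ring
    _ = _ := by
      rw [integral_sub h₁ (h₂.mul_const _), integral_mul_const, integral_complex_ofReal,
        integral_complex_ofReal, hodd]
      simp [minorant]

lemma fourier_minorantFourier :
    𝓕 (fun ξ ↦ (minorantFourier ξ : ℂ)) = fun u ↦ (minorant u : ℂ) := by
  ext u
  rw [← integral_minorantFourier_mul_cexp, Real.fourier_real_eq_integral_exp_smul]
  congr with ξ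
  rw [smul_eq_mul, mul_comm]
  congr 2
  push_cast
  ring

lemma continuous_minorant : Continuous minorant := by
  have h : minorant =
      fun u ↦ ∫ ξ in Set.Icc (-1 : ℝ) 1, minorantFourier ξ * Real.cos (2 * Real.pi * u * ξ) := by
    ext u
    rw [setIntegral_eq_integral_of_forall_compl_eq_zero]
    · rfl
    · intro ξ hξ
      simp [minorantFourier_eq_zero hξ]
  rw [h]
  refine continuous_parametric_integral_of_continuous ?_ isCompact_Icc
  have := continuous_minorantFourier
  fun_prop

lemma minorant_eq {u : ℝ} (hu : 1 < |u|) :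
    minorant u = -(Real.sin (Real.pi * u) ^ 2 / (Real.pi ^ 2 * u ^ 2 * (u ^ 2 - 1))) := by
  have hpi := Real.pi_ne_zero
  have hu2 : 1 < u ^ 2 := by nlinarith [sq_abs u]
  have hu0 : u ≠ 0 := by rintro rfl; norm_num at hu2
  have hu1 : 1 + u ≠ 0 := fun h ↦ by nlinarith
  have hu3 : 1 - u ≠ 0 := fun h ↦ by nlinarith
  have hu4 : u ^ 2 - 1 ≠ 0 := by linarith
  have hint : ∀ a b, IntervalIntegrable
      (fun ξ ↦ minorantFourier ξ * Real.cos (2 * Real.pi * u * ξ)) volume a b := fun a b ↦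
    (continuous_minorantFourier.mul (by fun_prop)).intervalIntegrable a b
  have hhalf : ∫ ξ in (0 : ℝ)..1, minorantFourier ξ * Real.cos (2 * Real.pi * u * ξ) =
      -(Real.sin (Real.pi * u) ^ 2 / (2 * Real.pi ^ 2 * u ^ 2 * (u ^ 2 - 1))) := by
    have hderiv : ∀ ξ ∈ Set.uIcc (0 : ℝ) 1, HasDerivAt (fun ξ : ℝ ↦
        (1 - ξ) * Real.sin (2 * Real.pi * u * ξ) / (2 * Real.pi * u)
          - Real.cos (2 * Real.pi * u * ξ) / (2 * Real.pi * u) ^ 2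
          - (Real.cos (2 * Real.pi * (1 + u) * ξ) / (8 * Real.pi ^ 2 * (1 + u))
            + Real.cos (2 * Real.pi * (1 - u) * ξ) / (8 * Real.pi ^ 2 * (1 - u))))
        (minorantFourier ξ * Real.cos (2 * Real.pi * u * ξ)) ξ := by
      intro ξ hξ
      rw [Set.uIcc_of_le zero_le_one] at hξ
      rw [minorantFourier_of_mem_Icc hξ.1 hξ.2]
      have hl : ∀ c : ℝ, HasDerivAt (fun ξ : ℝ ↦ c * ξ) c ξ := fun c ↦ by
        simpa using (hasDerivAt_id ξ).const_mul c
      have h := (((((hasDerivAt_id ξ).const_sub 1).mul (hl (2 * Real.pi * u)).sin).div_const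
        (2 * Real.pi * u)).sub ((hl (2 * Real.pi * u)).cos.div_const ((2 * Real.pi * u) ^ 2))).sub
        (((hl (2 * Real.pi * (1 + u))).cos.div_const (8 * Real.pi ^ 2 * (1 + u))).add
        ((hl (2 * Real.pi * (1 - u))).cos.div_const (8 * Real.pi ^ 2 * (1 - u))))
      refine h.congr_deriv ?_
      have e₁ : Real.sin (2 * Real.pi * (1 + u) * ξ) =
          Real.sin (2 * Real.pi * ξ) * Real.cos (2 * Real.pi * u * ξ) +
          Real.cos (2 * Real.pi * ξ) * Real.sin (2 * Real.pi * u * ξ) := by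
        rw [← Real.sin_add]; ring_nf
      have e₂ : Real.sin (2 * Real.pi * (1 - u) * ξ) =
          Real.sin (2 * Real.pi * ξ) * Real.cos (2 * Real.pi * u * ξ) -
          Real.cos (2 * Real.pi * ξ) * Real.sin (2 * Real.pi * u * ξ) := by
        rw [← Real.sin_sub]; ring_nf
      rw [e₁, e₂]
      simp only [id]
      field_simp
      ring
    rw [intervalIntegral.integral_eq_sub_of_hasDerivAt hderiv (hint 0 1)]
    have e₁ : Real.cos (2 * Real.pi * (1 + u) * 1) = Real.cos (2 * Real.pi * u * 1) := by
      rw [← Real.cos_add_two_pi (2 * Real.pi * u * 1)]; ring_nf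
    have e₂ : Real.cos (2 * Real.pi * (1 - u) * 1) = Real.cos (2 * Real.pi * u * 1) := by
      rw [← Real.cos_two_pi_sub (2 * Real.pi * u * 1)]; ring_nf
    have e₃ : Real.cos (2 * Real.pi * u * 1) = 1 - 2 * Real.sin (Real.pi * u) ^ 2 := by
      rw [mul_one, mul_assoc, Real.cos_two_mul, Real.cos_sq']; ring
    rw [e₁, e₂, e₃]
    simp only [mul_zero, Real.sin_zero, Real.cos_zero]
    have hu5 : 1 - u ^ 2 ≠ 0 := by linarith
    field_simp
    rw [show u ^ 2 - 1 = -((1 + u) * (1 - u)) by ring]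
    field_simp
    ring
  have hsymm : ∫ ξ in (-1 : ℝ)..0, minorantFourier ξ * Real.cos (2 * Real.pi * u * ξ) =
      ∫ ξ in (0 : ℝ)..1, minorantFourier ξ * Real.cos (2 * Real.pi * u * ξ) := by
    have h := intervalIntegral.integral_comp_neg (a := 0) (b := 1)
      (fun ξ ↦ minorantFourier ξ * Real.cos (2 * Real.pi * u * ξ))
    simp only [minorantFourier_neg, mul_neg, Real.cos_neg, neg_zero] at h
    exact h.symm
  have hall : minorant u =
      ∫ ξ in (-1 : ℝ)..1, minorantFourier ξ * Real.cos (2 * Real.pi * u * ξ) := by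
    rw [intervalIntegral.integral_of_le (by norm_num), ← integral_Icc_eq_integral_Ioc,
      setIntegral_eq_integral_of_forall_compl_eq_zero]
    · rfl
    · intro ξ hξ
      simp [minorantFourier_eq_zero hξ]
  rw [hall, ← intervalIntegral.integral_add_adjacent_intervals (hint _ 0) (hint _ _), hsymm, hhalf]
  field_simp
  ring

lemma minorant_nonpos {u : ℝ} (hu : 1 < |u|) : minorant u ≤ 0 := by
  rw [minorant_eq hu, neg_nonpos]
  have : 0 < u ^ 2 - 1 := by nlinarith [sq_abs u]
  positivity

lemma integrable_minorant : Integrable minorant := by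
  set M := ∫ ξ, |minorantFourier ξ|
  have hM : 0 ≤ M := integral_nonneg fun _ ↦ abs_nonneg _
  refine (integrable_inv_one_add_sq.const_mul (5 * M + 1)).mono'
    continuous_minorant.aestronglyMeasurable (Eventually.of_forall fun u ↦ ?_)
  rw [Real.norm_eq_abs, ← div_eq_mul_inv, le_div_iff₀ (by positivity)]
  have hle : |minorant u| ≤ M := by
    rw [minorant, ← Real.norm_eq_abs]
    refine norm_integral_le_of_norm_le integrable_minorantFourier.abs
      (Eventually.of_forall fun ξ ↦ ?_)
    rw [norm_mul]
    exact mul_le_of_le_one_right (norm_nonneg _) (Real.abs_cos_le_one _)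
  rcases le_or_gt |u| 2 with h | h
  · have : u ^ 2 ≤ 4 := by nlinarith [sq_abs u, abs_nonneg u]
    nlinarith [abs_nonneg (minorant u)]
  · have h4 : 4 < u ^ 2 := by nlinarith [sq_abs u]
    have hp : 1 ≤ Real.pi ^ 2 := by nlinarith [Real.pi_gt_three]
    rw [minorant_eq (by linarith), abs_neg, abs_of_nonneg
      (div_nonneg (by positivity) (mul_nonneg (by positivity) (by linarith))), div_mul_eq_mul_div,
      div_le_iff₀ (by have : 0 < u ^ 2 - 1 := by linarith
                      positivity)]
    have h1 := Real.sin_sq_le_one (Real.pi * u)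
    have h2 : 1 + u ^ 2 ≤ u ^ 2 * (u ^ 2 - 1) := by nlinarith
    have h3 : u ^ 2 * (u ^ 2 - 1) ≤ Real.pi ^ 2 * (u ^ 2 * (u ^ 2 - 1)) :=
      le_mul_of_one_le_left (by nlinarith) hp
    nlinarith

lemma integral_minorant : ∫ u, minorant u = 1 := by
  have hc : Continuous fun ξ ↦ (minorantFourier ξ : ℂ) :=
    Complex.continuous_ofReal.comp continuous_minorantFourier
  have h := congrFun (hc.fourierInv_fourier_eq integrable_minorantFourier.ofReal
    (by rw [fourier_minorantFourier]; exact integrable_minorant.ofReal)) 0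
  rw [fourier_minorantFourier, Real.fourierInv_eq'] at h
  simp only [inner_zero_right, mul_zero, Complex.ofReal_zero, zero_mul, Complex.exp_zero,
    one_smul, integral_complex_ofReal] at h
  rw [Complex.ofReal_inj] at h
  rw [h]
  simp [minorantFourier]

variable {t : ℕ} {a : ZMod t} {r ε y : ℝ}

/-- The vertical line on which `LFunctionResidueClassAux` is evaluated. -/
noncomputable def verticalLine (r ε ξ : ℝ) : ℂ :=
  (1 + ε : ℝ) + (2 * Real.pi * ξ / r : ℝ) * Complex.I

lemma verticalLine_re : (verticalLine r ε ξ).re = 1 + ε := by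
  simp [verticalLine]

lemma continuous_verticalLine : Continuous (verticalLine r ε) := by
  unfold verticalLine
  fun_prop

/-- The phase by which the translation to `y` acts on the Fourier side. -/
noncomputable def phase (r y ξ : ℝ) : ℂ :=
  Complex.exp ((2 * Real.pi * (y / r) * ξ : ℝ) * Complex.I)

lemma continuous_phase : Continuous (phase r y) := by
  unfold phase
  fun_prop

lemma norm_phase (ξ : ℝ) : ‖phase r y ξ‖ = 1 := Complex.norm_exp_ofReal_mul_I _

lemma term_verticalLine_mul_phase (n : ℕ) (ξ : ℝ) :
    phase r y ξ * LSeries.term (fun n ↦ (residueClass a n : ℂ)) (verticalLine r ε ξ) n =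
      (residueClass a n / (n : ℝ) ^ (1 + ε) : ℝ) *
        Complex.exp (-(2 * Real.pi * ((Real.log n - y) / r) * ξ : ℝ) * Complex.I) := by
  rcases eq_or_ne n 0 with rfl | hn
  · simp
  have hn' : (n : ℂ) ≠ 0 := by exact_mod_cast hn
  have hexp : Complex.exp (-(2 * Real.pi * ((Real.log n - y) / r) * ξ : ℝ) * Complex.I) =
      phase r y ξ * (Complex.exp (Complex.log n * ((2 * Real.pi * ξ / r : ℝ) * Complex.I)))⁻¹ := by
    rw [phase, ← Complex.exp_neg, ← Complex.exp_add, ← Complex.natCast_log]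
    congr 1
    push_cast
    ring
  rw [hexp, LSeries.term_of_ne_zero hn, Complex.ofReal_div, Complex.ofReal_cpow n.cast_nonneg,
    Complex.ofReal_natCast, verticalLine, Complex.cpow_add _ _ hn',
    Complex.cpow_def_of_ne_zero hn' ((2 * Real.pi * ξ / r : ℝ) * Complex.I)]
  ring

lemma hasSum_integral_LSeries (hε : 0 < ε) :
    HasSum (fun n : ℕ ↦ ((residueClass a n / (n : ℝ) ^ (1 + ε) *
        minorant ((Real.log n - y) / r) : ℝ) : ℂ))
      (∫ ξ, minorantFourier ξ * (phase r y ξ *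
        LSeries (fun n ↦ (residueClass a n : ℂ)) (verticalLine r ε ξ))) := by
  have key := hasSum_integral_of_summable_integral_norm (μ := volume)
    (F := fun (n : ℕ) (ξ : ℝ) ↦ (minorantFourier ξ : ℂ) * (phase r y ξ *
      LSeries.term (fun n ↦ (residueClass a n : ℂ)) (verticalLine r ε ξ) n)) ?_ ?_
  · have hterm : ∀ n : ℕ, ((residueClass a n / (n : ℝ) ^ (1 + ε) *
        minorant ((Real.log n - y) / r) : ℝ) : ℂ) = ∫ ξ, minorantFourier ξ * (phase r y ξ *
          LSeries.term (fun n ↦ (residueClass a n : ℂ)) (verticalLine r ε ξ) n) := fun n ↦ by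
      simp only [term_verticalLine_mul_phase, mul_left_comm (minorantFourier _ : ℂ)]
      rw [integral_const_mul, integral_minorantFourier_mul_cexp, Complex.ofReal_mul]
    simp only [tsum_mul_left] at key
    simp only [hterm]
    exact key
  · intro n
    refine integrable_minorantFourier_mul ?_
    simp_rw [term_verticalLine_mul_phase]
    fun_prop
  · have hs : LSeriesSummable (fun n ↦ (residueClass a n : ℂ)) ((1 + ε : ℝ) : ℂ) :=
      LSeriesSummable_of_abscissaOfAbsConv_lt_re <|
        (abscissaOfAbsConv_residueClass_le_one a).trans_lt <| by
          simpa using (by exact_mod_cast (by linarith) : (1 : EReal) < (1 + ε : ℝ))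
    refine (hs.norm.mul_left (∫ ξ, ‖minorantFourier ξ‖)).congr fun n ↦ ?_
    rw [← integral_mul_const]
    congr with ξ
    simp [norm_phase, LSeries.norm_term_eq, verticalLine_re]

lemma integral_exp_mul_minorant (hε : 0 < ε) :
    ((∫ v in Set.Ioi (0 : ℝ), Real.exp (-(ε * v)) * minorant ((v - y) / r) : ℝ) : ℂ) =
      ∫ ξ, minorantFourier ξ * (phase r y ξ * (verticalLine r ε ξ - 1)⁻¹) := by
  have hv : ∀ ξ : ℝ, phase r y ξ * (verticalLine r ε ξ - 1)⁻¹ =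
      ∫ v in Set.Ioi (0 : ℝ), (Real.exp (-(ε * v)) : ℂ) *
        Complex.exp (-(2 * Real.pi * ((v - y) / r) * ξ : ℝ) * Complex.I) := by
    intro ξ
    have h := integral_exp_mul_complex_Ioi (a := -(verticalLine r ε ξ - 1))
      (by simp [verticalLine_re, hε]) 0
    rw [Complex.ofReal_zero, mul_zero, Complex.exp_zero, neg_div_neg_eq, one_div] at h
    rw [← h, ← integral_const_mul]
    congr with v
    rw [phase, ← Complex.exp_add, Complex.ofReal_exp, ← Complex.exp_add, verticalLine]
    congr 1
    push_cast
    ring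
  simp_rw [hv, ← integral_const_mul]
  rw [integral_integral_swap, ← integral_complex_ofReal]
  · refine integral_congr_ae (Eventually.of_forall fun v ↦ ?_)
    simp only [mul_left_comm (minorantFourier _ : ℂ)]
    rw [integral_const_mul, integral_minorantFourier_mul_cexp, Complex.ofReal_mul]
  · have he : IntegrableOn (fun v ↦ Real.exp (-(ε * v))) (Set.Ioi 0) := by
      simpa using exp_neg_integrableOn_Ioi 0 hε
    refine ((integrable_minorantFourier.ofReal (𝕜 := ℂ)).mul_prod
      (he.ofReal (𝕜 := ℂ))).norm.mono' ?_ ?_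
    · have := continuous_minorantFourier
      refine Continuous.aestronglyMeasurable ?_
      unfold Function.uncurry
      fun_prop
    · refine Eventually.of_forall fun z ↦ le_of_eq ?_
      simp only [Function.uncurry, norm_mul, ← Complex.ofReal_neg, Complex.norm_exp_ofReal_mul_I,
        mul_one]
      rfl

variable [NeZero t]

lemma continuous_integral_residueClassAux (a : ZMod t) :
    Continuous fun ε ↦ ∫ ξ, minorantFourier ξ * (phase r y ξ *
      LFunctionResidueClassAux a (verticalLine r |ε| ξ)) := by
  have h : (fun ε ↦ ∫ ξ, minorantFourier ξ * (phase r y ξ *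
      LFunctionResidueClassAux a (verticalLine r |ε| ξ))) = fun ε ↦ ∫ ξ in Set.Icc (-1 : ℝ) 1,
      minorantFourier ξ * (phase r y ξ * LFunctionResidueClassAux a (verticalLine r |ε| ξ)) := by
    ext ε
    rw [setIntegral_eq_integral_of_forall_compl_eq_zero]
    intro ξ hξ
    simp [minorantFourier_eq_zero hξ]
  rw [h]
  refine continuous_parametric_integral_of_continuous ?_ isCompact_Icc
  have h₁ := continuous_minorantFourier
  have h₂ : Continuous (phase r y) := continuous_phase
  have h₃ : Continuous fun z : ℝ × ℝ ↦ LFunctionResidueClassAux a (verticalLine r |z.1| z.2) := by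
    refine (continuousOn_LFunctionResidueClassAux a).comp_continuous ?_ fun z ↦ ?_
    · unfold verticalLine
      fun_prop
    · simp [verticalLine_re]
  unfold Function.uncurry
  fun_prop

lemma continuous_integral_exp_mul_minorant (hr : 0 < r) :
    Continuous fun ε ↦ ∫ v in Set.Ioi (0 : ℝ), Real.exp (-(|ε| * v)) * minorant ((v - y) / r) := by
  have hm := continuous_minorant
  refine continuous_of_dominated (bound := fun v ↦ |minorant ((v - y) / r)|) ?_ ?_ ?_ ?_
  · intro ε
    exact Continuous.aestronglyMeasurable (by fun_prop)
  · intro ε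
    refine (ae_restrict_iff' measurableSet_Ioi).mpr (Eventually.of_forall fun v hv ↦ ?_)
    rw [norm_mul, Real.norm_of_nonneg (Real.exp_nonneg _)]
    refine mul_le_of_le_one_left (norm_nonneg _) (Real.exp_le_one_iff.mpr ?_)
    have := mul_nonneg (abs_nonneg ε) (le_of_lt hv)
    linarith
  · exact ((integrable_minorant.comp_div hr.ne').comp_sub_right y).abs.integrableOn
  · exact Eventually.of_forall fun v ↦ by fun_prop

lemma integral_minorant_le (ha : IsUnit a) (hr : 0 < r)
    (hy : ∀ n : ℕ, residueClass a n ≠ 0 → r < |Real.log n - y|) :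
    (t.totient : ℝ)⁻¹ * ∫ v in Set.Ioi (0 : ℝ), minorant ((v - y) / r) ≤
      -(∫ ξ, minorantFourier ξ * (phase r y ξ *
        LFunctionResidueClassAux a (verticalLine r 0 ξ))).re := by
  have hpos : ∀ ε > 0, (t.totient : ℝ)⁻¹ *
      ∫ v in Set.Ioi (0 : ℝ), Real.exp (-(|ε| * v)) * minorant ((v - y) / r) ≤
      -(∫ ξ, minorantFourier ξ * (phase r y ξ *
        LFunctionResidueClassAux a (verticalLine r |ε| ξ))).re := by
    intro ε hε
    rw [abs_of_pos hε]
    have hsum := hasSum_integral_LSeries (a := a) (r := r) (y := y) hε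
    have hnonpos : (∫ ξ, minorantFourier ξ * (phase r y ξ *
        LSeries (fun n ↦ (residueClass a n : ℂ)) (verticalLine r ε ξ))).re ≤ 0 := by
      refine (Complex.hasSum_re hsum).nonpos fun n ↦ ?_
      rw [Complex.ofReal_re]
      by_cases hn : residueClass a n = 0
      · simp [hn]
      · refine mul_nonpos_of_nonneg_of_nonpos
          (div_nonneg (residueClass_nonneg a n) (by positivity)) (minorant_nonpos ?_)
        rw [abs_div, abs_of_pos hr, one_lt_div hr]
        exact hy n hn
    have hline : ∀ ξ, LSeries (fun n ↦ (residueClass a n : ℂ)) (verticalLine r ε ξ) =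
        LFunctionResidueClassAux a (verticalLine r ε ξ) +
          (t.totient : ℂ)⁻¹ * (verticalLine r ε ξ - 1)⁻¹ := by
      intro ξ
      rw [eqOn_LFunctionResidueClassAux ha (by simp [verticalLine_re, hε])]
      ring
    have hne : ∀ ξ, verticalLine r ε ξ - 1 ≠ 0 := fun ξ h ↦ by
      have := congrArg Complex.re h
      simp [verticalLine_re] at this
      exact hε.ne' this
    have hcv : Continuous (verticalLine r ε) := continuous_verticalLine
    have hcp : Continuous (phase r y) := continuous_phase
    have hca : Continuous fun ξ ↦ LFunctionResidueClassAux a (verticalLine r ε ξ) :=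
      (continuousOn_LFunctionResidueClassAux a).comp_continuous hcv fun ξ ↦ by
        simp [verticalLine_re, hε.le]
    simp_rw [hline, mul_add] at hnonpos
    have hcr : Continuous fun ξ ↦ (verticalLine r ε ξ - 1)⁻¹ :=
      (hcv.sub continuous_const).inv₀ hne
    rw [integral_add (integrable_minorantFourier_mul (by fun_prop))
      (integrable_minorantFourier_mul (by fun_prop))] at hnonpos
    have hpole : ∫ ξ, minorantFourier ξ * (phase r y ξ *
        ((t.totient : ℂ)⁻¹ * (verticalLine r ε ξ - 1)⁻¹)) = ((t.totient : ℝ)⁻¹ *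
          ∫ v in Set.Ioi (0 : ℝ), Real.exp (-(ε * v)) * minorant ((v - y) / r) : ℝ) := by
      simp_rw [mul_left_comm _ (t.totient : ℂ)⁻¹]
      rw [integral_const_mul, ← integral_exp_mul_minorant hε]
      push_cast
      rfl
    rw [hpole, Complex.add_re, Complex.ofReal_re] at hnonpos
    linarith
  have h := le_of_tendsto_of_tendsto (b := 𝓝[>] (0 : ℝ))
    ((((continuous_integral_exp_mul_minorant (y := y) hr).const_mul
      (t.totient : ℝ)⁻¹).tendsto 0).mono_left nhdsWithin_le_nhds)
    (((Complex.continuous_re.comp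
      (continuous_integral_residueClassAux (r := r) (y := y) a)).neg.tendsto 0).mono_left
        nhdsWithin_le_nhds)
    (eventually_nhdsWithin_of_forall hpos)
  simpa using h

lemma tendsto_integral_minorant (hr : 0 < r) :
    Tendsto (fun y ↦ ∫ v in Set.Ioi (0 : ℝ), minorant ((v - y) / r)) atTop (𝓝 r) := by
  have hi : Integrable fun v ↦ minorant (v / r) := integrable_minorant.comp_div hr.ne'
  have h := (aecover_Ioi (μ := volume) (tendsto_neg_atTop_atBot (G := ℝ)))
    |>.integral_tendsto_of_countably_generated hi
  rw [Measure.integral_comp_div minorant, integral_minorant, abs_of_pos hr, smul_eq_mul,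
    mul_one] at h
  refine h.congr fun y ↦ ?_
  rw [← (measurePreserving_sub_right volume y).setIntegral_preimage_emb
    (measurableEmbedding_subRight y)]
  congr 2
  ext v
  simp

lemma tendsto_integral_residueClassAux (hr : 0 < r) :
    Tendsto (fun y ↦ ∫ ξ, minorantFourier ξ * (phase r y ξ *
      LFunctionResidueClassAux a (verticalLine r 0 ξ))) atTop (𝓝 0) := by
  have h := (Real.tendsto_integral_exp_smul_cocompact fun ξ ↦ (minorantFourier ξ : ℂ) *
    LFunctionResidueClassAux a (verticalLine r 0 ξ)).comp
    ((tendsto_neg_atTop_atBot.comp (tendsto_id.atTop_div_const hr)).mono_right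
      atBot_le_cocompact)
  refine h.congr fun y ↦ ?_
  simp only [Function.comp_apply, id]
  congr with ξ
  rw [Circle.smul_def, Real.fourierChar_apply, smul_eq_mul, mul_left_comm, phase]
  congr 4
  push_cast
  ring

/-- Short multiplicative intervals contain prime powers in a given residue class. -/
theorem eventually_exists_isPrimePow_log (ha : IsUnit a) (hr : 0 < r) :
    ∀ᶠ y in atTop, ∃ n : ℕ, IsPrimePow n ∧ (n : ZMod t) = a ∧ |Real.log n - y| ≤ r := by
  have ht : 0 < (t.totient : ℝ)⁻¹ := inv_pos.mpr (mod_cast t.totient.pos_of_neZero)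
  have h₁ := (tendsto_integral_minorant hr).const_mul (t.totient : ℝ)⁻¹
  have h₂ := ((Complex.continuous_re.tendsto 0).comp
    (tendsto_integral_residueClassAux (a := a) hr)).neg
  rw [Complex.zero_re, neg_zero] at h₂
  filter_upwards [h₂.eventually_lt h₁ (by positivity)] with y hy
  by_contra! hno
  refine hy.not_ge (integral_minorant_le ha hr fun n hn ↦ ?_)
  rw [residueClass, Set.indicator_apply_ne_zero] at hn
  exact hno n (vonMangoldt_ne_zero_iff.mp hn.2) hn.1

end PrimePowers

section Graph

variable {F : Type*} [Field F]

/-- The group of `t`-th powers of units. -/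
abbrev unitPowers (F : Type*) [Field F] (t : ℕ) : Subgroup Fˣ :=
  (powMonoidHom t : Fˣ →* Fˣ).range

/-- The incidence relation `(x + x') ^ t = y * y'` of a Füredi graph. -/
def FurediRel (t : ℕ) (p q : F × unitPowers F t) : Prop :=
  (p.1 + q.1) ^ t = ((p.2 : Fˣ) : F) * ((q.2 : Fˣ) : F)

lemma FurediRel.symm {t : ℕ} {p q : F × unitPowers F t} (h : FurediRel t p q) :
    FurediRel t q p := by
  rw [FurediRel] at h ⊢
  rw [add_comm, h, mul_comm]

/-- Two distinct vertices on the same side of a Füredi graph have at most `t` common neighbours. -/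
lemma FurediRel.card_le {t : ℕ} (ht : t ≠ 0) {p q : F × unitPowers F t} (hpq : p ≠ q)
    (s : Finset (F × unitPowers F t)) (hp : ∀ z ∈ s, FurediRel t p z)
    (hq : ∀ z ∈ s, FurediRel t q z) : s.card ≤ t := by
  classical
  open Polynomial in
  let P : F[X] := C ((q.2 : Fˣ) : F) * (X + C p.1) ^ t - C ((p.2 : Fˣ) : F) * (X + C q.1) ^ t
  have hP : P ≠ 0 := by
    intro h0
    have hev : ∀ b : F, ((q.2 : Fˣ) : F) * (b + p.1) ^ t = ((p.2 : Fˣ) : F) * (b + q.1) ^ t := by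
      intro b
      have := congrArg (Polynomial.eval b) h0
      simpa [P, sub_eq_zero] using this
    have h1 : p.1 = q.1 := by
      have h := hev (-p.1)
      rw [neg_add_cancel, zero_pow ht, mul_zero, eq_comm,
        mul_eq_zero_iff_left (Units.ne_zero _), pow_eq_zero_iff ht] at h
      exact (neg_add_eq_zero.mp h)
    have h2 := hev (1 - p.1)
    rw [← h1, sub_add_cancel, one_pow, mul_one, mul_one] at h2
    exact hpq (Prod.ext h1 (Subtype.ext (Units.ext h2.symm)))
  have hdeg : P.natDegree ≤ t := by
    have hd : ∀ b c : F, (Polynomial.C c * (Polynomial.X + Polynomial.C b) ^ t).natDegree ≤ t := by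
      intro b c
      refine (Polynomial.natDegree_C_mul_le _ _).trans ?_
      rw [Polynomial.natDegree_pow, Polynomial.natDegree_X_add_C, mul_one]
    exact (Polynomial.natDegree_sub_le _ _).trans (max_le (hd _ _) (hd _ _))
  have hinj : Set.InjOn Prod.fst (s : Set (F × unitPowers F t)) := by
    intro z hz w hw hzw
    have h1 := hp z hz
    have h2 := hp w hw
    rw [FurediRel, hzw] at h1
    rw [FurediRel, h1] at h2
    exact Prod.ext hzw (Subtype.ext (Units.ext (mul_left_cancel₀ (Units.ne_zero _) h2)))
  calc s.card = (s.image Prod.fst).card := (Finset.card_image_of_injOn hinj).symm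
    _ ≤ P.roots.toFinset.card := by
      refine Finset.card_le_card fun b hb ↦ ?_
      obtain ⟨z, hz, rfl⟩ := Finset.mem_image.mp hb
      have h1 := hp z hz
      have h2 := hq z hz
      rw [FurediRel] at h1 h2
      rw [Multiset.mem_toFinset, Polynomial.mem_roots hP, Polynomial.IsRoot]
      simp only [P, Polynomial.eval_sub, Polynomial.eval_mul, Polynomial.eval_C,
        Polynomial.eval_pow, Polynomial.eval_add, Polynomial.eval_X]
      rw [add_comm z.1, add_comm z.1, h1, h2]
      ring
    _ ≤ P.natDegree := (Multiset.toFinset_card_le _).trans (Polynomial.card_roots' _)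
    _ ≤ t := hdeg

/-- The bipartite Füredi graph. -/
def furediGraph (F : Type*) [Field F] (t : ℕ) :
    SimpleGraph ((F × unitPowers F t) ⊕ (F × unitPowers F t)) where
  Adj
    | .inl p, .inr q => FurediRel t p q
    | .inr p, .inl q => FurediRel t p q
    | _, _ => False
  symm := ⟨by
    rintro (p | p) (q | q) h
    · exact h
    · exact FurediRel.symm h
    · exact FurediRel.symm h
    · exact h⟩
  loopless := ⟨by rintro (p | p) h <;> exact h⟩

lemma furediGraph_colorable (t : ℕ) : (furediGraph F t).Colorable 2 := by
  have c : (furediGraph F t).Coloring Bool := Coloring.mk Sum.isLeft (by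
    rintro (p | p) (q | q) h
    · exact h.elim
    · simp
    · simp
    · exact h.elim)
  simpa using c.colorable

lemma furediGraph_card_le {t : ℕ} (ht : t ≠ 0) {u v : (F × unitPowers F t) ⊕ (F × unitPowers F t)}
    (huv : u ≠ v) (s : Finset ((F × unitPowers F t) ⊕ (F × unitPowers F t)))
    (hu : ∀ z ∈ s, (furediGraph F t).Adj u z) (hv : ∀ z ∈ s, (furediGraph F t).Adj v z) :
    s.card ≤ t := by
  rcases s.eq_empty_or_nonempty with rfl | ⟨z₀, hz₀⟩
  · simp
  rcases u with p | p <;> rcases v with q | q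
  · have hs : s.toLeft = ∅ := Finset.eq_empty_of_forall_notMem fun z hz ↦
      hu _ (Finset.mem_toLeft.mp hz)
    rw [← Finset.card_toLeft_add_card_toRight, hs, Finset.card_empty, zero_add]
    exact FurediRel.card_le ht (fun h ↦ huv (congrArg _ h)) _
      (fun z hz ↦ hu _ (Finset.mem_toRight.mp hz)) fun z hz ↦ hv _ (Finset.mem_toRight.mp hz)
  · rcases z₀ with z | z
    · exact (hu _ hz₀).elim
    · exact (hv _ hz₀).elim
  · rcases z₀ with z | z
    · exact (hv _ hz₀).elim
    · exact (hu _ hz₀).elim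
  · have hs : s.toRight = ∅ := Finset.eq_empty_of_forall_notMem fun z hz ↦
      hu _ (Finset.mem_toRight.mp hz)
    rw [← Finset.card_toLeft_add_card_toRight, hs, Finset.card_empty, add_zero]
    exact FurediRel.card_le ht (fun h ↦ huv (congrArg _ h)) _
      (fun z hz ↦ hu _ (Finset.mem_toLeft.mp hz)) fun z hz ↦ hv _ (Finset.mem_toLeft.mp hz)

lemma card_unitPowers [Finite F] {t : ℕ} (ht : t ∣ Nat.card F - 1) :
    Nat.card (unitPowers F t) = (Nat.card F - 1) / t := by
  rw [IsCyclic.card_powMonoidHom_range, Nat.card_units, Nat.gcd_eq_right ht]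

/-- Each choice of a left vertex `(x, y)` and a nonzero value of `x + x'` yields an edge. -/
lemma card_edgeSet_furediGraph [Finite F] (t : ℕ) :
    Nat.card F * Nat.card (unitPowers F t) * (Nat.card F - 1) ≤
      (furediGraph F t).edgeSet.ncard := by
  let f : (F × unitPowers F t) × Fˣ → Sym2 ((F × unitPowers F t) ⊕ (F × unitPowers F t)) :=
    fun w ↦ s(.inl w.1, .inr (w.2 - w.1.1, ⟨w.2 ^ t, w.2, rfl⟩ * w.1.2⁻¹))
  have hf : Function.Injective f := by
    rintro ⟨p, u⟩ ⟨q, v⟩ h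
    simp only [f, Sym2.eq_iff, Sum.inl.injEq, Sum.inr.injEq, reduceCtorEq, false_and, or_false] at h
    obtain ⟨rfl, h⟩ := h
    have h1 := congrArg Prod.fst h
    simp only [sub_left_inj] at h1
    rw [Units.ext h1]
  rw [← Nat.card_units, ← Nat.card_prod, ← Nat.card_prod, ← Set.ncard_univ,
    ← Set.ncard_image_of_injective _ hf]
  refine Set.ncard_le_ncard ?_ (Set.toFinite _)
  rintro _ ⟨⟨⟨x, y⟩, u⟩, -, rfl⟩
  change FurediRel t _ _
  simp only [FurediRel, add_sub_cancel, Subgroup.coe_mul, Units.val_mul, Units.val_pow_eq_pow_val,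
    InvMemClass.coe_inv]
  rw [mul_left_comm, Units.mul_inv, mul_one]

/-- A bipartite graph in which distinct vertices have at most `t` common neighbours embeds into
`Fin n`, whenever it has at most `n` vertices, without creating forbidden copies. -/
lemma exists_graph_fin {V W : Type*} [Finite V] {n t : ℕ} (B : SimpleGraph V) (hB : B.Colorable 2)
    (hcard : ∀ u v, u ≠ v → ∀ s : Finset V, (∀ z ∈ s, B.Adj u z) → (∀ z ∈ s, B.Adj v z) →
      s.card ≤ t)
    (hn : Nat.card V ≤ n) (H : SimpleGraph W) (hH : ¬ H.Colorable 2) :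
    ∃ (G : SimpleGraph (Fin n)) (_ : DecidableRel G.Adj), ¬ HasCopy H G ∧
      ¬ HasInducedCopy (completeBipartiteGraph (Fin 2) (Fin (t + 1))) G ∧
      B.edgeSet.ncard ≤ G.edgeFinset.card := by
  classical
  have := Fintype.ofFinite V
  obtain ⟨e⟩ : Nonempty (V ↪ Fin n) :=
    Function.Embedding.nonempty_of_card_le (by simpa [Nat.card_eq_fintype_card] using hn)
  refine ⟨B.map e, inferInstance, ?_, ?_, ?_⟩
  · rintro ⟨f, -, hf⟩
    obtain ⟨c⟩ := hB
    refine hH ⟨Coloring.mk (fun w ↦ Function.extend e c (fun _ ↦ 0) (f w)) fun {v w} hvw ↦ ?_⟩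
    obtain ⟨a, b, hab, ha, hb⟩ := (SimpleGraph.map_adj _ _ _ _).mp (hf v w hvw)
    rw [← ha, ← hb, e.injective.extend_apply, e.injective.extend_apply]
    exact c.valid hab
  · rintro ⟨φ⟩
    have hadj : ∀ i j, (B.map e).Adj (φ (.inl i)) (φ (.inr j)) := fun i j ↦
      φ.map_rel_iff.mpr (by simp)
    have hl : ∀ i, ∃ a, e a = φ (.inl i) := fun i ↦ by
      obtain ⟨a, b, -, ha, -⟩ := (SimpleGraph.map_adj _ _ _ _).mp (hadj i 0)
      exact ⟨a, ha⟩
    have hr : ∀ j, ∃ b, e b = φ (.inr j) := fun j ↦ by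
      obtain ⟨a, b, -, -, hb⟩ := (SimpleGraph.map_adj _ _ _ _).mp (hadj 0 j)
      exact ⟨b, hb⟩
    choose l hl using hl
    choose r hr using hr
    have hlr : ∀ i j, B.Adj (l i) (r j) := fun i j ↦ by
      have h := hadj i j
      rwa [← hl, ← hr, SimpleGraph.map_adj_apply] at h
    have hrinj : Function.Injective r := fun i j hij ↦ by
      have h := hr i
      rw [hij, hr j] at h
      exact (Sum.inr_injective (φ.injective h)).symm
    have hne : l 0 ≠ l 1 := fun h ↦ by
      have h' := hl 0
      rw [h, hl 1] at h'
      exact absurd (Sum.inl_injective (φ.injective h')) (by decide)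
    have h := hcard _ _ hne (Finset.univ.image r) (by simp [hlr]) (by simp [hlr])
    rw [Finset.card_image_of_injective _ hrinj, Finset.card_univ, Fintype.card_fin] at h
    omega
  · rw [SimpleGraph.card_edgeFinset_map, ← coe_edgeFinset, Set.ncard_coe_finset]

end Graph

lemma exists_field_card {q : ℕ} (hq : IsPrimePow q) :
    ∃ (F : Type) (_ : Field F), Finite F ∧ Nat.card F = q := by
  obtain ⟨p, k, hp, hk, rfl⟩ := hq
  have : Fact p.Prime := ⟨hp.nat_prime⟩
  exact ⟨GaloisField p k, inferInstance, inferInstance, GaloisField.card p k hk.ne'⟩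

/-- The real inequalities behind the choice of `q` just below `√(n t / 2)`. -/
lemma furedi_bounds {n t q : ℝ} (ht : 0 < t) (hn : 0 ≤ n) (hq : 100 ≤ q)
    (hu : q ≤ 0.707 * √(n * t)) (hl : 0.9 * (0.707 * √(n * t)) ≤ q) :
    2 * (q * ((q - 1) / t)) ≤ n ∧
      1 / 4 * √t * n ^ ((3 : ℝ) / 2) ≤ q * ((q - 1) / t) * (q - 1) := by
  set z := √(n * t) with hz
  have hz0 : 0 ≤ z := Real.sqrt_nonneg _
  have hz2 : z ^ 2 = n * t := Real.sq_sqrt (by positivity)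
  constructor
  · have h : 2 * (q * (q - 1)) ≤ n * t := by nlinarith
    calc 2 * (q * ((q - 1) / t)) = 2 * (q * (q - 1)) / t := by ring
      _ ≤ n := (div_le_iff₀ ht).mpr h
  · have h3 : √t * n ^ ((3 : ℝ) / 2) = z ^ 3 / t := by
      rw [hz, Real.sqrt_mul hn, show ((3 : ℝ) / 2) = 1 / 2 * (3 : ℕ) by norm_num,
        Real.rpow_mul_natCast hn, ← Real.sqrt_eq_rpow, mul_pow, eq_div_iff ht.ne']
      nth_rewrite 2 [← Real.sq_sqrt ht.le]
      ring
    have hq1 : 0.99 * q ≤ q - 1 := by linarith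
    calc 1 / 4 * √t * n ^ ((3 : ℝ) / 2) = 1 / 4 * z ^ 3 / t := by rw [mul_assoc, h3]; ring
      _ ≤ (0.9 * (0.707 * z)) ^ 3 * 0.99 ^ 2 / t := by
        refine div_le_div_of_nonneg_right ?_ ht.le
        have := pow_nonneg hz0 3
        linarith
      _ ≤ q ^ 3 * 0.99 ^ 2 / t := by gcongr
      _ = q * ((0.99 * q) / t) * (0.99 * q) := by ring
      _ ≤ q * ((q - 1) / t) * (q - 1) := by
        have : 0 ≤ q - 1 := by linarith
        gcongr

/-- **Lower bound.** For every `t ≥ 2` and every non-bipartite graph `H` (i.e. `H` is not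
2-colorable), there are `n`-vertex graphs with no `H` subgraph and no induced `K_{2,t+1}`
having at least `(1/4)√t·n^{3/2} − o(n^{3/2})` edges. -/
theorem stmt6 (t : ℕ) (ht : 2 ≤ t) {W : Type*} [Fintype W] (H : SimpleGraph W)
    (hH : ¬ H.Colorable 2) :
    ∀ ε > (0 : ℝ), ∃ N : ℕ, ∀ n ≥ N,
      ∃ (G : SimpleGraph (Fin n)) (_ : DecidableRel G.Adj),
        ¬ HasCopy H G ∧
        ¬ HasInducedCopy (completeBipartiteGraph (Fin 2) (Fin (t + 1))) G ∧
        (1 / 4 : ℝ) * Real.sqrt t * (n : ℝ) ^ ((3 : ℝ) / 2) - ε * (n : ℝ) ^ ((3 : ℝ) / 2)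
          ≤ (G.edgeFinset.card : ℝ) := by
  intro ε hε
  have : NeZero t := ⟨by omega⟩
  have ht0 : (0 : ℝ) < t := by exact_mod_cast (by omega : 0 < t)
  have hz : Filter.Tendsto (fun n : ℕ ↦ √((n : ℝ) * t)) Filter.atTop Filter.atTop :=
    Real.tendsto_sqrt_atTop.comp (tendsto_natCast_atTop_atTop.atTop_mul_const ht0)
  have hy : Filter.Tendsto (fun n : ℕ ↦ Real.log (0.707 * √((n : ℝ) * t)) - 0.05)
      Filter.atTop Filter.atTop :=
    Filter.tendsto_atTop_add_const_right _ _
      (Real.tendsto_log_atTop.comp (hz.const_mul_atTop (by norm_num)))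
  have hq := hy.eventually (eventually_exists_isPrimePow_log (a := (1 : ZMod t)) isUnit_one
    (by norm_num : (0 : ℝ) < 0.05))
  obtain ⟨N, hN⟩ := Filter.eventually_atTop.mp (hq.and (hz.eventually_ge_atTop 1000))
  refine ⟨N, fun n hn ↦ ?_⟩
  obtain ⟨⟨q, hqp, hqt, hqy⟩, hz1⟩ := hN n hn
  have hz0 : (0 : ℝ) < 0.707 * √((n : ℝ) * t) := by linarith
  have hq0 : (0 : ℝ) < q := by exact_mod_cast hqp.pos
  rw [abs_le] at hqy
  have hu : (q : ℝ) ≤ 0.707 * √((n : ℝ) * t) :=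
    (Real.log_le_log_iff hq0 hz0).mp (by linarith)
  have hl : 0.9 * (0.707 * √((n : ℝ) * t)) ≤ q := by
    refine (Real.log_le_log_iff (by positivity) hq0).mp ?_
    have := Real.log_le_sub_one_of_pos (by norm_num : (0 : ℝ) < 0.9)
    rw [Real.log_mul (by norm_num) hz0.ne']
    linarith
  have hq100 : (100 : ℝ) ≤ q := by linarith
  obtain ⟨hv, he⟩ := furedi_bounds ht0 n.cast_nonneg hq100 hu hl
  have hdvd : t ∣ q - 1 := by
    rw [← ZMod.natCast_eq_zero_iff, Nat.cast_sub hqp.pos, hqt, Nat.cast_one, sub_self]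
  obtain ⟨F, _, _, hF⟩ := exists_field_card hqp
  have hU : Nat.card (unitPowers F t) = (q - 1) / t := by
    rw [card_unitPowers (by rwa [hF]), hF]
  have hcast : (((q - 1) / t : ℕ) : ℝ) = ((q : ℝ) - 1) / t := by
    rw [Nat.cast_div hdvd ht0.ne', Nat.cast_sub hqp.pos, Nat.cast_one]
  obtain ⟨G, hG, h1, h2, h3⟩ := exists_graph_fin (n := n) (furediGraph F t)
    (furediGraph_colorable t)
    (fun u v huv ↦ furediGraph_card_le (NeZero.ne t) huv)
    (by
      rw [Nat.card_sum, Nat.card_prod, hU, hF, ← two_mul]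
      rw [← hcast] at hv
      exact_mod_cast hv) H hH
  refine ⟨G, hG, h1, h2, ?_⟩
  have hE := (card_edgeSet_furediGraph (F := F) t).trans h3
  rw [hF, hU] at hE
  have hE' : (q : ℝ) * (((q : ℝ) - 1) / t) * (q - 1) ≤ G.edgeFinset.card := by
    have : ((q * ((q - 1) / t) * (q - 1) : ℕ) : ℝ) ≤ G.edgeFinset.card := by exact_mod_cast hE
    rwa [Nat.cast_mul, Nat.cast_mul, hcast, Nat.cast_sub hqp.pos, Nat.cast_one] at this
  have : 0 ≤ ε * (n : ℝ) ^ ((3 : ℝ) / 2) := by positivity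
  linarith
end

section
/- For any integers k ≥ 2 and t ≥ 2, there is a constant β_k depending only on k such that every n-vertex graph with no C_{2k+1} subgraph and no induced K_{2,t} has at most (α(k,t)^{1/2} + 1)^{1/2} · n^{3/2}/2 + β_k · n^{1+1/(2k)} edges, where α(k,t) = (2k−2)(t−1)((2k−2)(t−1) − 1). -/
open SimpleGraph Finset

/-- A closed list of adjacent distinct vertices gives a copy of a cycle. -/
lemma hasCopy_cycleGraph_of_isChain {V : Type*} {G : SimpleGraph V} {x : V} {l : List V} {N : ℕ}
    (hnd : (x :: l).Nodup) (hc : List.IsChain G.Adj (x :: (l ++ [x])))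
    (hN : (x :: l).length = N) : HasCopy (cycleGraph N) G := by
  subst hN
  have key : ∀ u v : Fin (x :: l).length, (u - v).val = 1 →
      G.Adj ((x :: l).get v) ((x :: l).get u) := by
    intro u v huv
    rw [List.isChain_iff_getElem] at hc
    have hlen : (x :: (l ++ [x])).length = (x :: l).length + 1 := by simp
    have hv := hc v.val (by have := v.2; omega)
    have e1 : (x :: (l ++ [x]))[v.val]'(by have := v.2; omega) = (x :: l).get v := by
      simp only [← List.cons_append, List.get_eq_getElem]
      rw [List.getElem_append_left]
    rw [e1] at hv
    convert hv using 1
    by_cases h : v ≤ u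
    · rw [Fin.sub_val_of_le h] at huv
      have : u.val = v.val + 1 := by omega
      simp only [← List.cons_append, List.get_eq_getElem]
      rw [List.getElem_append_left (by have := u.2; omega)]
      congr 1
    · push Not at h
      rw [Fin.coe_sub_iff_lt.2 h] at huv
      have := v.2
      have := u.2
      have h1 : u.val = 0 := by omega
      have h2 : v.val + 1 = (x :: l).length := by omega
      simp only [← List.cons_append, List.get_eq_getElem]
      rw [List.getElem_append_right (by omega)]
      simp [h1]
  refine ⟨(x :: l).get, List.nodup_iff_injective_get.1 hnd, fun a b hab => ?_⟩
  rcases cycleGraph_adj'.1 hab with h | h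
  · exact (key _ _ h).symm
  · exact key _ _ h

/-- A set in which independent sets have size at most `t` contains a path on `j + 1` vertices as
soon as it has more than `j * t` elements. -/
lemma exists_isChain_of_indepSet_card_le {V : Type*} [DecidableEq V] {G : SimpleGraph V} {t : ℕ}
    (j : ℕ) : ∀ S : Finset V, (∀ I ⊆ S, G.IsIndepSet (I : Set V) → #I ≤ t) → j * t < #S →
      ∃ (x : V) (l : List V), l.length = j ∧ (x :: l).Nodup ∧ (∀ v ∈ x :: l, v ∈ S) ∧
        List.IsChain G.Adj (x :: l) := by
  classical
  induction j with
  | zero =>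
    intro S _ h
    obtain ⟨x, hx⟩ := Finset.card_pos.1 (by simpa using h)
    exact ⟨x, [], by simp [hx]⟩
  | succ j ih =>
    intro S hS h
    obtain ⟨I, hI, hmax⟩ := Finset.exists_max_image
      (S.powerset.filter fun I : Finset V => G.IsIndepSet (I : Set V)) Finset.card ⟨∅, by simp⟩
    simp only [Finset.mem_filter, Finset.mem_powerset] at hI hmax
    have hcard : j * t < #(S \ I) := by
      have h1 := hS I hI.1 hI.2
      have h2 := Finset.card_sdiff_add_card_eq_card hI.1
      nlinarith
    obtain ⟨x, l, hl, hnd, hmem, hc⟩ :=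
      ih (S \ I) (fun J hJ => hS J (hJ.trans Finset.sdiff_subset)) hcard
    have hx := Finset.mem_sdiff.1 (hmem x (by simp))
    have : ∃ y ∈ I, G.Adj y x := by
      by_contra! hno
      have := hmax (insert x I) ⟨Finset.insert_subset hx.1 hI.1, by
        rw [Finset.coe_insert]
        refine Set.Pairwise.insert hI.2 fun b hb _ => ⟨fun hab => hno b hb hab.symm, hno b hb⟩⟩
      rw [Finset.card_insert_of_notMem hx.2] at this
      omega
    obtain ⟨y, hyI, hyx⟩ := this
    refine ⟨y, x :: l, by simp [hl], List.nodup_cons.2 ⟨fun hy => ?_, hnd⟩, ?_, ?_⟩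
    · exact (Finset.mem_sdiff.1 (hmem y hy)).2 hyI
    · intro v hv
      rcases List.mem_cons.1 hv with rfl | hv
      · exact hI.1 hyI
      · exact (Finset.mem_sdiff.1 (hmem v hv)).1
    · exact List.isChain_cons_cons.2 ⟨hyx, hc⟩

/-- An independent set in the common neighbourhood of two non-adjacent vertices spans an induced
complete bipartite graph with them. -/
lemma hasInducedCopy_completeBipartiteGraph {V : Type*} {G : SimpleGraph V} {x y : V}
    (hxy : x ≠ y) (hnadj : ¬ G.Adj x y) {t : ℕ} {I : Finset V} (hI : G.IsIndepSet (I : Set V))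
    (hx : ∀ v ∈ I, G.Adj x v) (hy : ∀ v ∈ I, G.Adj y v) (ht : t ≤ #I) :
    HasInducedCopy (completeBipartiteGraph (Fin 2) (Fin t)) G := by
  obtain ⟨J, hJ, rfl⟩ := Finset.exists_subset_card_eq ht
  let e := J.equivFin.symm
  have hz : ∀ i : Fin 2, ∀ v ∈ J, G.Adj (![x, y] i) v := by
    intro i v hv
    fin_cases i
    · exact hx v (hJ hv)
    · exact hy v (hJ hv)
  have hzz : ∀ i j : Fin 2, ¬ G.Adj (![x, y] i) (![x, y] j) := by
    intro i j
    fin_cases i <;> fin_cases j <;> simp [hnadj, G.adj_comm y x]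
  have hinj : Function.Injective ![x, y] := by
    intro i j
    fin_cases i <;> fin_cases j <;> simp [hxy, hxy.symm]
  have hadj : ∀ i j : Fin #J, ¬ G.Adj (e i) (e j) := fun i j h =>
    hI (hJ (e i).2) (hJ (e j).2) h.ne h
  refine ⟨⟨⟨Sum.elim ![x, y] fun i => (e i : V), ?_⟩, ?_⟩⟩
  · refine hinj.sumElim (Subtype.val_injective.comp e.injective) fun i j h => ?_
    exact (hz i _ (e j).2).ne h
  · rintro (i | i) (j | j)
    · simpa using hzz i j
    · simpa using hz i _ (e j).2
    · simpa using (hz j _ (e i).2).symm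
    · simpa using hadj i j

/-- In a `C_{2k+1}`-free graph without induced `K_{2,t+1}`, non-adjacent vertices have at most
`(2k-2)t` common neighbours. -/
lemma card_common_neighbors_le {V : Type*} [DecidableEq V] {G : SimpleGraph V} {k t : ℕ}
    (hk : 2 ≤ k) (hC : ¬ HasCopy (cycleGraph (2 * k + 1)) G)
    (hK : ¬ HasInducedCopy (completeBipartiteGraph (Fin 2) (Fin (t + 1))) G) {x y : V}
    (hxy : x ≠ y) (hnadj : ¬ G.Adj x y) {S : Finset V} (hx : ∀ v ∈ S, G.Adj x v)
    (hy : ∀ v ∈ S, G.Adj y v) : #S ≤ (2 * k - 2) * t := by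
  by_contra! hlt
  obtain ⟨v, l, hl, hnd, hmem, hc⟩ := exists_isChain_of_indepSet_card_le (G := G) (2 * k - 2) S
    (fun I hI hind => by
      by_contra! h
      exact hK (hasInducedCopy_completeBipartiteGraph hxy hnadj hind
        (fun v hv => hx v (hI hv)) (fun v hv => hy v (hI hv)) h)) hlt
  have hxS : ∀ w ∈ v :: l, x ≠ w := fun w hw => (hx w (hmem w hw)).ne
  have hyS : ∀ w ∈ v :: l, y ≠ w := fun w hw => (hy w (hmem w hw)).ne
  refine hC (hasCopy_cycleGraph_of_isChain (x := x) (l := v :: y :: l) ?_ ?_ ?_)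
  · simp only [List.nodup_cons, List.mem_cons, not_or] at hnd ⊢
    exact ⟨⟨hxS v (by simp), hxy, fun h => hxS x (by simp [h]) rfl⟩,
      ⟨(hyS v (by simp)).symm, hnd.1⟩, fun h => hyS y (by simp [h]) rfl, hnd.2⟩
  · match l, hl with
    | [], hl => simp at hl; omega
    | w :: l', hl =>
      simp only [List.cons_append, List.isChain_cons_cons]
      refine ⟨hx v (hmem v (by simp)), (hy v (hmem v (by simp))).symm, hy w (hmem w (by simp)), ?_⟩
      rw [← List.cons_append]
      refine List.IsChain.append (List.isChain_cons_cons.1 hc).2 (List.isChain_singleton _) ?_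
      intro a ha b hb
      simp only [List.head?_cons, Option.mem_def, Option.some.injEq] at hb
      subst hb
      have : a ∈ w :: l' := List.mem_of_mem_getLast? ha
      exact (hx a (hmem a (by simp [List.mem_cons.1 this]))).symm
  · simp [hl]; omega

/-- The ordered pairs of distinct vertices lying together in a member of a set family. -/
def pairShadow {V : Type*} [Fintype V] [DecidableEq V] (𝒯 : Finset (Finset V)) : Finset (V × V) :=
  Finset.univ.filter fun p => p.1 ≠ p.2 ∧ ∃ T ∈ 𝒯, p.1 ∈ T ∧ p.2 ∈ T

lemma mem_pairShadow {V : Type*} [Fintype V] [DecidableEq V] {𝒯 : Finset (Finset V)} {p : V × V} :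
    p ∈ pairShadow 𝒯 ↔ p.1 ≠ p.2 ∧ ∃ T ∈ 𝒯, p.1 ∈ T ∧ p.2 ∈ T := by
  simp [pairShadow]

/-- A set family with many more members than shadow pairs has a nonempty subfamily
all of whose shadow pairs lie in many members. -/
lemma exists_subfamily_forall_lt_card {V : Type*} [Fintype V] [DecidableEq V] (m : ℕ)
    (𝒯 : Finset (Finset V)) (h : m * #(pairShadow 𝒯) < #𝒯) :
    ∃ 𝒮 ⊆ 𝒯, 𝒮.Nonempty ∧ ∀ p ∈ pairShadow 𝒮, m < #{T ∈ 𝒮 | p.1 ∈ T ∧ p.2 ∈ T} := by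
  induction hn : #𝒯 using Nat.strong_induction_on generalizing 𝒯 with
  | _ n ih =>
  by_cases hall : ∀ p ∈ pairShadow 𝒯, m < #{T ∈ 𝒯 | p.1 ∈ T ∧ p.2 ∈ T}
  · exact ⟨𝒯, subset_rfl, Finset.card_pos.1 (by omega), hall⟩
  push Not at hall
  obtain ⟨p, hp, hpm⟩ := hall
  set 𝒰 := {T ∈ 𝒯 | ¬ (p.1 ∈ T ∧ p.2 ∈ T)} with h𝒰
  have hsum : #{T ∈ 𝒯 | p.1 ∈ T ∧ p.2 ∈ T} + #𝒰 = #𝒯 :=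
    Finset.card_filter_add_card_filter_not _
  have hsub : 𝒰 ⊆ 𝒯 := Finset.filter_subset _ _
  have hpos : 0 < #{T ∈ 𝒯 | p.1 ∈ T ∧ p.2 ∈ T} := by
    obtain ⟨-, T, hT, hT'⟩ := mem_pairShadow.1 hp
    exact Finset.card_pos.2 ⟨T, Finset.mem_filter.2 ⟨hT, hT'⟩⟩
  have hlt : #(pairShadow 𝒰) < #(pairShadow 𝒯) := by
    refine Finset.card_lt_card (Finset.ssubset_iff_subset_ne.2 ⟨fun q hq => ?_, fun heq => ?_⟩)
    · obtain ⟨hne, T, hT, hT'⟩ := mem_pairShadow.1 hq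
      exact mem_pairShadow.2 ⟨hne, T, hsub hT, hT'⟩
    · rw [← heq] at hp
      obtain ⟨-, T, hT, hT'⟩ := mem_pairShadow.1 hp
      exact (Finset.mem_filter.1 hT).2 hT'
  have hmul : m * #(pairShadow 𝒰) + m ≤ m * #(pairShadow 𝒯) := by
    rw [← Nat.mul_succ]
    exact Nat.mul_le_mul_left m hlt
  obtain ⟨𝒮, h𝒮, h⟩ := ih #𝒰 (by omega) 𝒰 (by omega) rfl
  exact ⟨𝒮, h𝒮.trans hsub, h⟩

/-- If every shadow pair of a nonempty family of triples lies in more than `m` triples, the shadow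
contains cycles of all lengths from `3` to `m + 1`. -/
lemma exists_isChain_pairShadow {V : Type*} [Fintype V] [DecidableEq V] {m : ℕ}
    {𝒮 : Finset (Finset V)} (hne : 𝒮.Nonempty) (h3 : ∀ T ∈ 𝒮, #T = 3)
    (h : ∀ p ∈ pairShadow 𝒮, m < #{T ∈ 𝒮 | p.1 ∈ T ∧ p.2 ∈ T}) (j : ℕ) (hj : j + 2 ≤ m) :
    ∃ (x y : V) (l : List V), (x :: y :: l).length = j + 3 ∧ (x :: y :: l).Nodup ∧
      List.IsChain (fun a b => (a, b) ∈ pairShadow 𝒮) (x :: y :: (l ++ [x])) := by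
  induction j with
  | zero =>
    obtain ⟨T, hT⟩ := hne
    obtain ⟨x, y, z, hxy, hxz, hyz, rfl⟩ := Finset.card_eq_three.1 (h3 T hT)
    refine ⟨x, y, [z], by simp, by simp [hxy, hxz, hyz], ?_⟩
    simp only [List.cons_append, List.nil_append, List.isChain_cons_cons, mem_pairShadow]
    exact ⟨⟨hxy, _, hT, by simp⟩, ⟨hyz, _, hT, by simp⟩, ⟨hxz.symm, _, hT, by simp⟩,
      List.isChain_singleton _⟩
  | succ j ih =>
    obtain ⟨x, y, l, hlen, hnd, hc⟩ := ih (by omega)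
    rw [List.isChain_cons_cons] at hc
    have hxy : x ≠ y := (mem_pairShadow.1 hc.1).1
    obtain ⟨T, hT, hT'⟩ : ∃ T ∈ {T ∈ 𝒮 | x ∈ T ∧ y ∈ T},
        T ∉ (x :: y :: l).toFinset.image fun z => ({x, y, z} : Finset V) := by
      apply Finset.exists_mem_notMem_of_card_lt_card
      refine lt_of_le_of_lt Finset.card_image_le ?_
      have := h _ hc.1
      have := List.toFinset_card_le (x :: y :: l)
      simp only at *
      omega
    obtain ⟨hT, hxT, hyT⟩ := Finset.mem_filter.1 hT
    obtain ⟨z, hz⟩ : ∃ z, T = {x, y, z} := by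
      have hsub : ({x, y} : Finset V) ⊆ T := by
        intro a ha
        rcases Finset.mem_insert.1 ha with rfl | ha
        · exact hxT
        · rwa [Finset.mem_singleton.1 ha]
      have hcard : #(T \ {x, y}) = 1 := by
        rw [Finset.card_sdiff_of_subset hsub, h3 T hT, Finset.card_pair hxy]
      obtain ⟨z, hz⟩ := Finset.card_eq_one.1 hcard
      refine ⟨z, ?_⟩
      rw [← Finset.union_sdiff_of_subset hsub, hz]
      ext a
      simp
    have hzl : z ∉ x :: y :: l := fun hmem =>
      hT' (Finset.mem_image.2 ⟨z, List.mem_toFinset.2 hmem, hz.symm⟩)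
    simp only [List.mem_cons, not_or] at hzl
    subst hz
    refine ⟨x, z, y :: l, by simp at hlen ⊢; omega, ?_, ?_⟩
    · simp only [List.nodup_cons, List.mem_cons, not_or] at hnd ⊢
      exact ⟨⟨Ne.symm hzl.1, hnd.1⟩, hzl.2, hnd.2⟩
    · simp only [List.cons_append, List.isChain_cons_cons]
      exact ⟨mem_pairShadow.2 ⟨Ne.symm hzl.1, _, hT, by simp⟩,
        mem_pairShadow.2 ⟨hzl.2.1, _, hT, by simp⟩, hc.2⟩

/-- A complete bipartite subgraph with a triangle on one of its edges contains all odd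
cycles up to the size of its parts. -/
lemma exists_isChain_of_completeBipartite {V : Type*} [DecidableEq V] {G : SimpleGraph V}
    {A B : Finset V} {a b z : V} (hAB : ∀ x ∈ A, ∀ y ∈ B, G.Adj x y) (ha : a ∈ A) (hb : b ∈ B)
    (haz : G.Adj a z) (hbz : G.Adj b z) (j : ℕ) (hA : 2 * j + 3 ≤ #A) (hB : 2 * j + 3 ≤ #B) :
    ∃ x ∈ A, ∃ y ∈ B, ∃ l : List V, (x :: y :: l).length = 2 * j + 3 ∧ (x :: y :: l).Nodup ∧
      List.IsChain G.Adj (x :: y :: (l ++ [x])) := by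
  induction j with
  | zero =>
    refine ⟨a, ha, b, hb, [z], by simp, by simp [(hAB a ha b hb).ne, haz.ne, hbz.ne], ?_⟩
    simp [hAB a ha b hb, hbz, haz.symm]
  | succ j ih =>
    obtain ⟨x, hx, y, hy, l, hlen, hnd, hc⟩ := ih (by omega) (by omega)
    have hcard := List.toFinset_card_le (x :: y :: l)
    obtain ⟨u, hu, hul⟩ := Finset.exists_mem_notMem_of_card_lt_card
      (show #(x :: y :: l).toFinset < #A by omega)
    obtain ⟨v, hv, hvl⟩ := Finset.exists_mem_notMem_of_card_lt_card
      (show #(x :: y :: l).toFinset < #B by omega)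
    have huv := (hAB u hu v hv).ne
    simp only [List.mem_toFinset, List.mem_cons, not_or] at hul hvl
    rw [List.isChain_cons_cons] at hc
    refine ⟨x, hx, v, hv, u :: y :: l, by simp at hlen ⊢; omega, ?_, ?_⟩
    · simp only [List.nodup_cons, List.mem_cons, not_or] at hnd ⊢
      exact ⟨⟨Ne.symm hvl.1, Ne.symm hul.1, hnd.1⟩, ⟨Ne.symm huv, hvl.2⟩, hul.2, hnd.2⟩
    · simp only [List.cons_append, List.isChain_cons_cons]
      exact ⟨hAB x hx v hv, (hAB u hu v hv).symm, hAB u hu y hy, hc.2⟩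

/-- A dense binary relation on a large finite type contains a complete bipartite one. -/
lemma exists_completeBipartite_of_dense (s : ℕ) {η : ℝ} (hη : 0 < η) :
    ∃ n₀ : ℕ, ∀ n ≥ n₀, ∀ P : Finset (Fin n × Fin n), η * n ^ 2 < #P →
      ∃ A B : Finset (Fin n), s < #A ∧ s < #B ∧ ∀ a ∈ A, ∀ b ∈ B, (a, b) ∈ P := by
  set r : ℝ := ((s + 1 : ℕ) : ℝ) with hr
  have hr0 : 0 < r := by positivity
  refine ⟨⌈2 * r / η + r * (2 / η) ^ (s + 1)⌉₊ + 1, fun n hn P hP => ?_⟩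
  have hn' : 2 * r / η + r * (2 / η) ^ (s + 1) < n :=
    (Nat.le_ceil _).trans_lt (Nat.cast_lt.2 hn)
  have hn0 : (0 : ℝ) < n := lt_of_le_of_lt (by positivity) hn'
  by_contra! hno
  let N : Fin n → Finset (Fin n) := fun v => {u | (v, u) ∈ P}
  have hsum : ∑ v, #(N v) = #P := by
    have := Finset.card_eq_sum_card_fiberwise (f := Prod.fst) (s := P) (t := Finset.univ)
      (fun _ _ => Finset.mem_coe.2 (Finset.mem_univ _))
    rw [this]
    refine Finset.sum_congr rfl fun v _ => ?_
    refine Finset.card_bij (fun u _ => (v, u)) ?_ ?_ ?_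
    · simp [N]
    · simp
    · rintro ⟨a, b⟩ hab
      simp only [Finset.mem_filter] at hab
      obtain ⟨h1, rfl⟩ := hab
      exact ⟨b, by simpa [N] using h1, rfl⟩
  have hcount : ∑ v, (#(N v)).choose (s + 1) ≤ (s + 1) * n.choose (s + 1) := by
    have h1 := Finset.sum_card_bipartiteAbove_eq_sum_card_bipartiteBelow
      (s := (Finset.univ : Finset (Fin n))) (t := Finset.powersetCard (s + 1) Finset.univ)
      (fun v S => S ⊆ N v)
    have h2 : ∀ v, #(Finset.bipartiteAbove (fun v S => S ⊆ N v)
        (Finset.powersetCard (s + 1) Finset.univ) v) = (#(N v)).choose (s + 1) := by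
      intro v
      rw [← Finset.card_powersetCard]
      congr 1
      ext S
      simp [Finset.bipartiteAbove, Finset.mem_powersetCard, and_comm]
    simp only [h2] at h1
    rw [h1]
    refine (Finset.sum_le_card_nsmul _ _ (s + 1) fun S hS => ?_).trans ?_
    · by_contra! hlt
      rw [Finset.mem_powersetCard] at hS
      obtain ⟨a, ha, b, hb, hab⟩ := hno (Finset.bipartiteBelow (fun v S => S ⊆ N v)
        Finset.univ S) S (by omega) (by omega)
      have := (Finset.mem_bipartiteBelow _).1 ha |>.2 hb
      exact hab (by simpa [N] using this)
    · simp [mul_comm]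
  have hpow : ∑ v, (#(N v) + 1 - (s + 1)) ^ (s + 1) ≤ (s + 1) * n ^ (s + 1) := by
    calc ∑ v, (#(N v) + 1 - (s + 1)) ^ (s + 1)
        ≤ ∑ v, (s + 1).factorial * (#(N v)).choose (s + 1) := by
          gcongr with v
          rw [← Nat.descFactorial_eq_factorial_mul_choose]
          exact Nat.pow_sub_le_descFactorial _ _
      _ = (s + 1).factorial * ∑ v, (#(N v)).choose (s + 1) := by rw [Finset.mul_sum]
      _ ≤ (s + 1).factorial * ((s + 1) * n.choose (s + 1)) := by gcongr
      _ = (s + 1) * n.descFactorial (s + 1) := by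
          rw [Nat.descFactorial_eq_factorial_mul_choose]; ring
      _ ≤ (s + 1) * n ^ (s + 1) := by gcongr; exact Nat.descFactorial_le_pow _ _
  have hmean := pow_sum_div_card_le_sum_pow (s := (Finset.univ : Finset (Fin n)))
    (f := fun v => ((#(N v) + 1 - (s + 1) : ℕ) : ℝ)) (fun _ _ => Nat.cast_nonneg _) s
  have hP' : η * n ^ 2 - r * n ≤ ∑ v, ((#(N v) + 1 - (s + 1) : ℕ) : ℝ) := by
    have h1 : ∀ v ∈ (Finset.univ : Finset (Fin n)),
        (#(N v) : ℝ) - r ≤ ((#(N v) + 1 - (s + 1) : ℕ) : ℝ) := by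
      intro v _
      rw [sub_le_iff_le_add, hr, ← Nat.cast_add]
      exact Nat.cast_le.2 (by omega)
    have h2 := Finset.sum_le_sum h1
    rw [Finset.sum_sub_distrib, ← Nat.cast_sum, hsum] at h2
    simp only [Finset.sum_const, Finset.card_univ, Fintype.card_fin, nsmul_eq_mul] at h2
    linarith
  have h1 : 2 * r / η < n := lt_of_le_of_lt (le_add_of_nonneg_right (by positivity)) hn'
  have h2 : r * (2 / η) ^ (s + 1) < n :=
    lt_of_le_of_lt (le_add_of_nonneg_left (by positivity)) hn'
  rw [div_lt_iff₀ hη] at h1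
  have hP'' : η / 2 * n ^ 2 ≤ ∑ v, ((#(N v) + 1 - (s + 1) : ℕ) : ℝ) := by
    refine le_trans ?_ hP'
    nlinarith
  have hpow' : ∑ v, ((#(N v) + 1 - (s + 1) : ℕ) : ℝ) ^ (s + 1) ≤ r * n ^ (s + 1) := by
    rw [hr]
    exact_mod_cast hpow
  have h3 : (η / 2 * n ^ 2) ^ (s + 1) ≤ r * n ^ (s + 1) * n ^ s := by
    have h4 := hmean.trans hpow'
    rw [Finset.card_univ, Fintype.card_fin, div_le_iff₀ (by positivity)] at h4
    exact (pow_le_pow_left₀ (by positivity) hP'' _).trans h4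
  have h5 : (η / 2) ^ (s + 1) * n ≤ r := by
    refine le_of_mul_le_mul_right (a := (n : ℝ) ^ (2 * s + 1)) ?_ (by positivity)
    calc (η / 2) ^ (s + 1) * n * n ^ (2 * s + 1) = (η / 2 * n ^ 2) ^ (s + 1) := by ring
      _ ≤ r * n ^ (s + 1) * n ^ s := h3
      _ = r * n ^ (2 * s + 1) := by ring
  have h6 : (η / 2) ^ (s + 1) * (2 / η) ^ (s + 1) = 1 := by
    rw [← mul_pow, div_mul_div_cancel₀ two_ne_zero, div_self hη.ne', one_pow]
  have h7 : 0 < (η / 2) ^ (s + 1) := by positivity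
  nlinarith [mul_lt_mul_of_pos_left h2 h7]

/-- A `C_{2k+1}`-free graph has few triangles. -/
lemma card_triangles_le_of_not_hasCopy {k : ℕ} (hk : 1 ≤ k) {η : ℝ} (hη : 0 < η) :
    ∃ n₀ : ℕ, ∀ n ≥ n₀, ∀ (G : SimpleGraph (Fin n)) [DecidableRel G.Adj],
      ¬ HasCopy (cycleGraph (2 * k + 1)) G → (#(G.cliqueFinset 3) : ℝ) ≤ η * n ^ 2 := by
  have hk' : (0 : ℝ) < ((2 * k : ℕ) : ℝ) := by exact_mod_cast (by omega : 0 < 2 * k)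
  obtain ⟨n₀, hn₀⟩ := exists_completeBipartite_of_dense (2 * k) (div_pos hη hk')
  refine ⟨n₀, fun n hn G _ hC => ?_⟩
  by_contra! hT
  have hadj : ∀ p ∈ pairShadow (G.cliqueFinset 3), G.Adj p.1 p.2 := by
    intro p hp
    obtain ⟨hne, T, hT, h1, h2⟩ := mem_pairShadow.1 hp
    exact (mem_cliqueFinset_iff.1 hT).isClique h1 h2 hne
  by_cases hS : 2 * k * #(pairShadow (G.cliqueFinset 3)) < #(G.cliqueFinset 3)
  · obtain ⟨𝒮, hsub, hne, h⟩ := exists_subfamily_forall_lt_card _ _ hS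
    obtain ⟨x, y, l, hlen, hnd, hc⟩ := exists_isChain_pairShadow hne
      (fun T hT => (mem_cliqueFinset_iff.1 (hsub hT)).card_eq) h (2 * k - 2) (by omega)
    refine hC (hasCopy_cycleGraph_of_isChain hnd (hc.imp fun a b hab => ?_) (by omega))
    obtain ⟨hne, T, hT, hT'⟩ := mem_pairShadow.1 hab
    exact hadj (a, b) (mem_pairShadow.2 ⟨hne, T, hsub hT, hT'⟩)
  · have hlt : η / (2 * k : ℕ) * n ^ 2 < #(pairShadow (G.cliqueFinset 3)) := by
      rw [div_mul_eq_mul_div, div_lt_iff₀ hk']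
      refine hT.trans_le ?_
      rw [mul_comm]
      exact_mod_cast not_lt.1 hS
    obtain ⟨A, B, hA, hB, hAB⟩ := hn₀ n hn _ hlt
    obtain ⟨a, ha⟩ := Finset.card_pos.1 (by omega : 0 < #A)
    obtain ⟨b, hb⟩ := Finset.card_pos.1 (by omega : 0 < #B)
    obtain ⟨hne, T, hT, haT, hbT⟩ := mem_pairShadow.1 (hAB a ha b hb)
    have hTc := mem_cliqueFinset_iff.1 hT
    obtain ⟨z, hzT, hz⟩ := Finset.exists_mem_notMem_of_card_lt_card
      (s := {a, b}) (t := T) (by rw [hTc.card_eq]; exact Finset.card_le_two.trans_lt (by omega))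
    simp only [Finset.mem_insert, Finset.mem_singleton, not_or] at hz
    obtain ⟨x, -, y, -, l, hlen, hnd, hc⟩ := exists_isChain_of_completeBipartite (G := G)
      (fun x hx y hy => hadj _ (hAB x hx y hy)) ha hb
      (hTc.isClique haT hzT (Ne.symm hz.1)) (hTc.isClique hbT hzT (Ne.symm hz.2)) (k - 1)
      (by omega) (by omega)
    exact hC (hasCopy_cycleGraph_of_isChain hnd hc (by omega))

/-- Codegrees of adjacent pairs are bounded on average by the number of triangles. -/
lemma sum_card_common_neighbors_adj_le {V : Type*} [Fintype V] [DecidableEq V]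
    (G : SimpleGraph V) [DecidableRel G.Adj] :
    ∑ x, ∑ y, (if G.Adj x y then #(G.neighborFinset x ∩ G.neighborFinset y) else 0) ≤
      27 * #(G.cliqueFinset 3) := by
  have h1 : ∑ x, ∑ y, (if G.Adj x y then #(G.neighborFinset x ∩ G.neighborFinset y) else 0) =
      #{p : V × V × V | G.Adj p.1 p.2.1 ∧ G.Adj p.1 p.2.2 ∧ G.Adj p.2.1 p.2.2} := by
    rw [Finset.card_filter, Fintype.sum_prod_type]
    refine Finset.sum_congr rfl fun x _ => ?_
    rw [Fintype.sum_prod_type]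
    refine Finset.sum_congr rfl fun y _ => ?_
    split_ifs with h
    · simp only [h, true_and, ← Finset.card_filter]
      congr 1
      ext v
      simp
    · simp [h]
  rw [h1]
  refine Finset.card_le_mul_card_image_of_maps_to
    (f := fun p : V × V × V => ({p.1, p.2.1, p.2.2} : Finset V)) ?_ 27 ?_
  · intro p hp
    rw [Finset.mem_filter] at hp
    exact mem_cliqueFinset_iff.2 (is3Clique_triple_iff.2 hp.2)
  · intro T hT
    have hcard : #(T ×ˢ T ×ˢ T) = 27 := by
      simp [Finset.card_product, (mem_cliqueFinset_iff.1 hT).card_eq]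
    rw [← hcard]
    refine Finset.card_le_card fun p hp => ?_
    have := (Finset.mem_filter.1 hp).2
    subst this
    simp

/-- Double counting of paths with two edges. -/
lemma sum_card_common_neighbors {V : Type*} [Fintype V] [DecidableEq V]
    (G : SimpleGraph V) [DecidableRel G.Adj] :
    ∑ x, ∑ y, #(G.neighborFinset x ∩ G.neighborFinset y) = ∑ v, G.degree v ^ 2 := by
  have h1 : ∀ x y, #(G.neighborFinset x ∩ G.neighborFinset y) =
      ∑ v, (if G.Adj v x then 1 else 0) * (if G.Adj v y then 1 else 0) := by
    intro x y
    simp only [mul_ite, mul_one, mul_zero, ← ite_and, ← Finset.card_filter]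
    congr 1
    ext v
    simp [G.adj_comm v, and_comm]
  have h2 : ∀ v, G.degree v = ∑ x, if G.Adj v x then 1 else 0 := by
    intro v
    rw [← Finset.card_filter, ← G.card_neighborFinset_eq_degree]
    congr 1
    ext x
    simp
  simp only [h1, h2, sq, Finset.sum_mul_sum]
  rw [Finset.sum_comm_cycle]

/-- The second moment of the degrees when non-adjacent vertices have bounded codegree. -/
lemma sum_degree_sq_le {V : Type*} [Fintype V] [DecidableEq V]
    (G : SimpleGraph V) [DecidableRel G.Adj] {D : ℕ}
    (hD : ∀ x y, x ≠ y → ¬ G.Adj x y → #(G.neighborFinset x ∩ G.neighborFinset y) ≤ D) :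
    ∑ v, G.degree v ^ 2 ≤
      Fintype.card V ^ 2 * D + 2 * #G.edgeFinset + 27 * #(G.cliqueFinset 3) := by
  have hle : ∀ x y, #(G.neighborFinset x ∩ G.neighborFinset y) ≤
      D + (if x = y then G.degree x else 0) +
        (if G.Adj x y then #(G.neighborFinset x ∩ G.neighborFinset y) else 0) := by
    intro x y
    by_cases hxy : x = y
    · subst hxy
      simp
    · by_cases h : G.Adj x y
      · simp [h]
      · simpa [h, hxy] using hD x y hxy h
  calc ∑ v, G.degree v ^ 2 = ∑ x, ∑ y, #(G.neighborFinset x ∩ G.neighborFinset y) :=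
        (sum_card_common_neighbors G).symm
    _ ≤ ∑ x, ∑ y, (D + (if x = y then G.degree x else 0) +
        (if G.Adj x y then #(G.neighborFinset x ∩ G.neighborFinset y) else 0)) :=
        Finset.sum_le_sum fun x _ => Finset.sum_le_sum fun y _ => hle x y
    _ = Fintype.card V ^ 2 * D + 2 * #G.edgeFinset + ∑ x, ∑ y,
        (if G.Adj x y then #(G.neighborFinset x ∩ G.neighborFinset y) else 0) := by
        simp only [Finset.sum_add_distrib, ← G.sum_degrees_eq_twice_card_edges]
        simp [sq, mul_assoc]
    _ ≤ _ := by gcongr; exact sum_card_common_neighbors_adj_le G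

/-- **Theorem 4.** For `k ≥ 2` there is a constant `β_k`, depending only on `k`, such that
for every `t ≥ 2`, every `n`-vertex graph with no `C_{2k+1}` subgraph and no induced
`K_{2,t}` has at most `(α(k,t)^{1/2} + 1)^{1/2}·n^{3/2}/2 + β_k·n^{1+1/(2k)}` edges,
where `α(k,t) = (2k−2)(t−1)((2k−2)(t−1) − 1)`. -/
theorem stmt7 (k : ℕ) (hk : 2 ≤ k) :
    ∃ β : ℝ, ∀ t : ℕ, 2 ≤ t → ∀ (n : ℕ) (G : SimpleGraph (Fin n)) [DecidableRel G.Adj],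
      ¬ HasCopy (cycleGraph (2 * k + 1)) G →
      ¬ HasInducedCopy (completeBipartiteGraph (Fin 2) (Fin t)) G →
      (G.edgeFinset.card : ℝ) ≤
        ((((2 * k - 2) * (t - 1) * ((2 * k - 2) * (t - 1) - 1) : ℕ) : ℝ) ^ ((1 : ℝ) / 2)
            + 1) ^ ((1 : ℝ) / 2) * (n : ℝ) ^ ((3 : ℝ) / 2) / 2 +
          β * (n : ℝ) ^ (1 + 1 / (2 * (k : ℝ))) := by
  obtain ⟨n₀, hn₀⟩ := card_triangles_le_of_not_hasCopy (k := k) (by omega)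
    (η := 1 / 270) (by norm_num)
  refine ⟨n₀ + 1, fun t ht n G _ hC hK => ?_⟩
  have hchoose : #G.edgeFinset ≤ n ^ 2 := by
    refine (card_edgeFinset_le_card_choose_two (G := G)).trans ?_
    simpa using Nat.choose_le_pow n 2
  rcases Nat.eq_zero_or_pos n with rfl | hnpos
  · have h0 : #G.edgeFinset = 0 := by simpa using hchoose
    rw [h0, Nat.cast_zero]
    positivity
  have hn1 : (1 : ℝ) ≤ n := by exact_mod_cast hnpos
  have hself : (n : ℝ) ≤ (n : ℝ) ^ (1 + 1 / (2 * (k : ℝ))) :=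
    Real.self_le_rpow_of_one_le hn1 (le_add_of_nonneg_right (by positivity))
  have hβ : ((n₀ : ℝ) + 1) * n ≤ (n₀ + 1) * (n : ℝ) ^ (1 + 1 / (2 * (k : ℝ))) := by gcongr
  have hmain : 0 ≤ ((((2 * k - 2) * (t - 1) * ((2 * k - 2) * (t - 1) - 1) : ℕ) : ℝ) ^
      ((1 : ℝ) / 2) + 1) ^ ((1 : ℝ) / 2) * (n : ℝ) ^ ((3 : ℝ) / 2) / 2 := by positivity
  rcases lt_or_ge n n₀ with hlt | hge
  · have h1 : (#G.edgeFinset : ℝ) ≤ (n : ℝ) ^ 2 := by exact_mod_cast hchoose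
    have h2 : (n : ℝ) ≤ n₀ := by exact_mod_cast hlt.le
    nlinarith
  have hT := hn₀ n hge G hC
  obtain ⟨D, hD⟩ : ∃ D, (2 * k - 2) * (t - 1) = D := ⟨_, rfl⟩
  have hD2 : 2 ≤ D := by
    rw [← hD]
    exact (Nat.mul_le_mul (by omega : 2 ≤ 2 * k - 2) (by omega : 1 ≤ t - 1))
  have hcodeg : ∀ x y, x ≠ y → ¬ G.Adj x y →
      #(G.neighborFinset x ∩ G.neighborFinset y) ≤ D := by
    intro x y hxy hadj
    rw [← hD]
    refine card_common_neighbors_le hk hC (by rwa [Nat.sub_add_cancel (by omega)]) hxy hadj ?_ ?_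
    · intro v hv
      simpa using (Finset.mem_inter.1 hv).1
    · intro v hv
      simpa using (Finset.mem_inter.1 hv).2
  have hsq := sum_degree_sq_le G hcodeg
  have hcs := sq_sum_le_card_mul_sum_sq (s := (Finset.univ : Finset (Fin n))) 
    (f := fun v => G.degree v)
  rw [G.sum_degrees_eq_twice_card_edges] at hcs
  simp only [Finset.card_univ, Fintype.card_fin] at hcs hsq
  have hquad := hcs.trans (Nat.mul_le_mul_left n hsq)
  rw [hD]
  rw [hD] at hmain
  set S : ℝ := ((D * (D - 1) : ℕ) : ℝ) ^ ((1 : ℝ) / 2) + 1 with hS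
  have hSD : (D : ℝ) + 1 / 10 ≤ S := by
    have hD2' : (2 : ℝ) ≤ D := by exact_mod_cast hD2
    rw [hS, ← Real.sqrt_eq_rpow, ← sub_le_iff_le_add]
    refine Real.le_sqrt_of_sq_le ?_
    rw [Nat.cast_mul, Nat.cast_sub (by omega), Nat.cast_one]
    nlinarith
  have hS0 : 0 ≤ S := le_trans (by positivity) hSD
  set Q : ℝ := S ^ ((1 : ℝ) / 2) * (n : ℝ) ^ ((3 : ℝ) / 2) with hQ
  have hQ0 : 0 ≤ Q := by positivity
  have hQ2 : Q ^ 2 = S * n ^ 3 := by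
    rw [hQ, mul_pow, ← Real.rpow_natCast, ← Real.rpow_natCast, ← Real.rpow_mul hS0,
      ← Real.rpow_mul (by positivity), ← Real.rpow_natCast]
    norm_num
  have hE : (2 * #G.edgeFinset : ℝ) ≤ Q + n := by
    have hquad' : (2 * #G.edgeFinset : ℝ) ^ 2 ≤
        n * (n ^ 2 * D + 2 * #G.edgeFinset + 27 * #(G.cliqueFinset 3)) := by
      exact_mod_cast hquad
    have h3 : (2 * #G.edgeFinset : ℝ) ^ 2 ≤ n * (2 * #G.edgeFinset) + Q ^ 2 := by
      have h4 : (n : ℝ) * (27 * #(G.cliqueFinset 3)) ≤ n * (27 * (1 / 270 * n ^ 2)) := by gcongr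
      have h5 : ((D : ℝ) + 1 / 10) * n ^ 3 ≤ S * n ^ 3 := by gcongr
      rw [hQ2]
      linarith
    by_contra! hlt
    nlinarith
  have hn₀' : (0 : ℝ) ≤ n₀ := Nat.cast_nonneg _
  nlinarith
end

section
/- For k ≥ s ≥ 3, every n-vertex graph with no C_{2k+1} subgraph and no induced K_{s,s} has at most (4^s (s−1)^{1/s} (2k−3)^{1/s} / (s!)^{1/s}) · n^{2−1/s} + o(n^{2−1/s}) edges. -/
open SimpleGraph Finset

/-- The list `l` is a path of `G` all of whose vertices lie in `A`. -/
def IsPathIn {V : Type*} (G : SimpleGraph V) (A : Finset V) (l : List V) : Prop :=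
  l.Nodup ∧ l.IsChain G.Adj ∧ ∀ x ∈ l, x ∈ A

/-- A closed path on `m` vertices, given as a list, is a copy of the cycle of length `m`. -/
lemma hasCopy_cycleGraph_of_list {V : Type*} {G : SimpleGraph V} {m : ℕ} (l : List V)
    (hlen : l.length = m) (hm : 2 ≤ m) (hnd : l.Nodup) (hch : l.IsChain G.Adj)
    (hclose : G.Adj (l[m - 1]'(by omega)) (l[0]'(by omega))) :
    HasCopy (cycleGraph m) G := by
  obtain ⟨r, rfl⟩ : ∃ r, m = r + 2 := ⟨m - 2, by omega⟩
  have key : ∀ a b : Fin (r + 2), a - b = 1 →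
      G.Adj (l[b.val]'(by omega)) (l[a.val]'(by omega)) := by
    intro a b hab
    obtain rfl : a = b + 1 := by rw [← hab]; abel
    by_cases hb : b = Fin.last (r + 1)
    · subst hb
      simpa using hclose
    · have hv : (b + 1).val = b.val + 1 := Fin.val_add_one_of_lt (Fin.lt_last_iff_ne_last.2 hb)
      have hlt := Fin.val_lt_last hb
      have := List.isChain_iff_getElem.1 hch b.val (by omega)
      simpa only [hv] using this
  refine ⟨fun i => l[i.val]'(by omega), fun i j hij => ?_, fun a b hab => ?_⟩
  · exact Fin.ext ((List.Nodup.getElem_inj_iff hnd).1 hij)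
  · rcases cycleGraph_adj.1 hab with h | h
    · exact (key a b h).symm
    · exact key b a h

/-- A Gallai–Roy type bound: a set of more than `m * s` vertices whose independent subsets have at
most `s` elements contains an increasing path on `m + 1` vertices. -/
lemma exists_increasing_path {V : Type*} [LinearOrder V] (G : SimpleGraph V) (s m : ℕ) :
    ∀ A : Finset V, (∀ B ⊆ A, G.IsIndepSet B → #B ≤ s) → m * s < #A →
      ∃ l : List V, l.IsChain (fun a b => a < b ∧ G.Adj a b) ∧ (∀ x ∈ l, x ∈ A) ∧
        l.length = m + 1 := by
  classical
  induction m with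
  | zero =>
    intro A _ hA
    obtain ⟨x, hx⟩ := Finset.card_pos.1 (by omega : 0 < #A)
    exact ⟨[x], by simp, by simpa using hx, rfl⟩
  | succ m ih =>
    intro A hind hA
    set I := A.filter (fun x => ∀ y ∈ A, y < x → ¬ G.Adj y x) with hI
    have hIind : G.IsIndepSet (I : Set V) := by
      intro x hx y hy hxy hadj
      simp only [hI, coe_filter, Set.mem_ofPred_eq] at hx hy
      rcases lt_or_gt_of_ne hxy with h | h
      · exact hy.2 x hx.1 h hadj
      · exact hx.2 y hy.1 h hadj.symm
    have hIc := hind I (filter_subset _ _) hIind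
    have hcard : #(A \ I) + #I = #A := card_sdiff_add_card_eq_card (filter_subset _ _)
    obtain ⟨l, hl, hlA, hlen⟩ := ih (A \ I)
      (fun B hB => hind B (hB.trans sdiff_subset)) (by rw [Nat.succ_mul] at hA; omega)
    match l, hlen with
    | x :: t, hlen =>
      have hx := hlA x (by simp)
      simp only [hI, mem_sdiff, mem_filter, not_and, not_forall, not_not] at hx
      obtain ⟨y, hy, hyx, hadj⟩ := hx.2 hx.1
      refine ⟨y :: x :: t, List.isChain_cons_cons.2 ⟨⟨hyx, hadj⟩, hl⟩, ?_, by simpa using hlen⟩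
      intro z hz
      rcases List.mem_cons.1 hz with rfl | hz
      · exact hy
      · exact (mem_sdiff.1 (hlA z hz)).1

lemma exists_isPathIn_of_card {V : Type*} [LinearOrder V] (G : SimpleGraph V) (s m : ℕ)
    (A : Finset V) (hind : ∀ B ⊆ A, G.IsIndepSet B → #B ≤ s) (hA : m * s < #A) :
    ∃ l, IsPathIn G A l ∧ l.length = m + 1 := by
  obtain ⟨l, hl, hlA, hlen⟩ := exists_increasing_path G s m A hind hA
  refine ⟨l, ⟨?_, hl.imp fun _ _ h => h.2, hlA⟩, hlen⟩
  exact ((hl.imp fun _ _ h => h.1).pairwise : l.Pairwise (· < ·)).imp fun h => ne_of_lt h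

/-- A nonempty vertex set inducing minimum degree at least `m` contains a path on `m + 1`
vertices. -/
lemma exists_isPathIn_of_minDegree {V : Type*} [DecidableEq V] (G : SimpleGraph V)
    [DecidableRel G.Adj] (A : Finset V) (hA : A.Nonempty) (m : ℕ)
    (hdeg : ∀ x ∈ A, m ≤ #{y ∈ A | G.Adj x y}) :
    ∀ j ≤ m, ∃ l, IsPathIn G A l ∧ l.length = j + 1 := by
  intro j
  induction j with
  | zero =>
    obtain ⟨x, hx⟩ := hA
    exact fun _ => ⟨[x], ⟨by simp, by simp, by simpa using hx⟩, rfl⟩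
  | succ j ih =>
    intro hj
    obtain ⟨l, ⟨hnd, hch, hlA⟩, hlen⟩ := ih (by omega)
    match l, hlen with
    | x :: t, hlen =>
      have hlt : #t.toFinset < #{y ∈ A | G.Adj x y} := by
        have h1 := hdeg x (hlA x (by simp))
        have h2 := List.toFinset_card_le t
        simp only [List.length_cons] at hlen
        omega
      obtain ⟨y, hy, hyt⟩ := exists_mem_notMem_of_card_lt_card hlt
      rw [mem_filter] at hy
      rw [List.mem_toFinset] at hyt
      refine ⟨y :: x :: t, ⟨?_, List.isChain_cons_cons.2 ⟨hy.2.symm, hch⟩, ?_⟩,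
        by simpa using hlen⟩
      · refine List.nodup_cons.2 ⟨?_, hnd⟩
        rw [List.mem_cons, not_or]
        exact ⟨hy.2.ne', hyt⟩
      · intro z hz
        rcases List.mem_cons.1 hz with rfl | hz
        · exact hy.1
        · exact hlA z hz

/-- A vertex set without paths on `m + 1` vertices spans at most `2 * m * #A` ordered adjacent
pairs. -/
lemma card_adj_pairs_le {V : Type*} [DecidableEq V] (G : SimpleGraph V)
    [DecidableRel G.Adj] (m : ℕ) (A : Finset V)
    (hpath : ∀ l, IsPathIn G A l → l.length ≠ m + 1) :
    #{p ∈ A ×ˢ A | G.Adj p.1 p.2} ≤ 2 * m * #A := by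
  induction A using Finset.strongInduction with
  | H A ih =>
    rcases A.eq_empty_or_nonempty with rfl | hA
    · simp
    obtain ⟨x, hx, hdeg⟩ : ∃ x ∈ A, #{y ∈ A | G.Adj x y} < m := by
      by_contra! h
      obtain ⟨l, hl, hlen⟩ := exists_isPathIn_of_minDegree G A hA m h m le_rfl
      exact hpath l hl hlen
    have hrec := ih (A.erase x) (erase_ssubset hx)
      fun l hl => hpath l ⟨hl.1, hl.2.1, fun z hz => mem_of_mem_erase (hl.2.2 z hz)⟩
    have hsub : {p ∈ A ×ˢ A | G.Adj p.1 p.2} ⊆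
        ({p ∈ A.erase x ×ˢ A.erase x | G.Adj p.1 p.2} ∪
          {y ∈ A | G.Adj x y}.image (fun y => (x, y))) ∪
          {y ∈ A | G.Adj x y}.image (fun y => (y, x)) := by
      rintro ⟨a, b⟩ hab
      simp only [mem_filter, mem_product, mem_union, mem_image, mem_erase, Prod.mk.injEq] at hab ⊢
      by_cases ha : a = x
      · subst ha
        exact .inl (.inr ⟨b, ⟨hab.1.2, hab.2⟩, rfl, rfl⟩)
      by_cases hb : b = x
      · subst hb
        exact .inr ⟨a, ⟨hab.1.1, hab.2.symm⟩, rfl, rfl⟩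
      exact .inl (.inl ⟨⟨⟨ha, hab.1.1⟩, hb, hab.1.2⟩, hab.2⟩)
    have h1 := card_le_card hsub
    have h2 := card_union_le ({p ∈ A.erase x ×ˢ A.erase x | G.Adj p.1 p.2} ∪
      {y ∈ A | G.Adj x y}.image (fun y => (x, y))) ({y ∈ A | G.Adj x y}.image (fun y => (y, x)))
    have h3 := card_union_le {p ∈ A.erase x ×ˢ A.erase x | G.Adj p.1 p.2}
      ({y ∈ A | G.Adj x y}.image (fun y => (x, y)))
    have h4 := card_image_le (s := {y ∈ A | G.Adj x y}) (f := fun y => (x, y))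
    have h5 := card_image_le (s := {y ∈ A | G.Adj x y}) (f := fun y => (y, x))
    have h6 : #(A.erase x) + 1 = #A := card_erase_add_one hx
    rw [← h6, mul_add, mul_one]
    omega

/-- In a `C_{2k+1}`-free graph no neighbourhood contains a path on `2k` vertices. -/
lemma length_ne_of_isPathIn_neighbors {V : Type*} {G : SimpleGraph V} {k : ℕ} (hk : 1 ≤ k)
    (hC : ¬ HasCopy (cycleGraph (2 * k + 1)) G) (v : V) (A : Finset V)
    (hA : ∀ x ∈ A, G.Adj v x) (l : List V) (hl : IsPathIn G A l) : l.length ≠ 2 * k := by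
  intro hlen
  obtain ⟨hnd, hch, hlA⟩ := hl
  refine hC (hasCopy_cycleGraph_of_list (v :: l) (by simp [hlen]) (by omega) ?_ ?_ ?_)
  · exact List.nodup_cons.2 ⟨fun h => (hA v (hlA v h)).ne rfl, hnd⟩
  · exact List.isChain_cons.2 ⟨fun y hy => hA y (hlA y (List.mem_of_mem_head? hy)), hch⟩
  · obtain ⟨j, rfl⟩ : ∃ j, k = j + 1 := ⟨k - 1, by omega⟩
    exact (hA _ (hlA _ (List.getElem_mem (by omega : 2 * j + 1 < l.length)))).symm

/-- In a `C_{2k+1}`-free graph, the common neighbourhood of three distinct vertices contains no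
path on `2k - 2` vertices. -/
lemma length_ne_of_isPathIn_common_neighbors {V : Type*} {G : SimpleGraph V} {k : ℕ} (hk : 3 ≤ k)
    (hC : ¬ HasCopy (cycleGraph (2 * k + 1)) G) (a b c : V) (hab : a ≠ b) (hac : a ≠ c)
    (hbc : b ≠ c) (A : Finset V) (ha : ∀ x ∈ A, G.Adj a x) (hb : ∀ x ∈ A, G.Adj b x)
    (hc : ∀ x ∈ A, G.Adj c x) (l : List V) (hl : IsPathIn G A l) : l.length ≠ 2 * k - 2 := by
  intro hlen
  obtain ⟨hnd, hch, hlA⟩ := hl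
  have haA : a ∉ A := fun h => (ha a h).ne rfl
  have hbA : b ∉ A := fun h => (hb b h).ne rfl
  have hcA : c ∉ A := fun h => (hc c h).ne rfl
  obtain ⟨j, rfl⟩ : ∃ j, k = j + 3 := ⟨k - 3, by omega⟩
  match l, hlen with
  | x :: y :: z :: w :: t, hlen =>
    have hlast : (x :: y :: z :: w :: t)[2 * j + 3]'(by rw [hlen]; omega) ∈ A :=
      hlA _ (List.getElem_mem _)
    simp only [List.mem_cons, forall_eq_or_imp] at hlA
    simp only [List.isChain_cons_cons] at hch
    obtain ⟨hx, hy, hz, hw, ht⟩ := hlA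
    have hat : a ∉ t := fun h => haA (ht a h)
    have hbt : b ∉ t := fun h => hbA (ht b h)
    have hct : c ∉ t := fun h => hcA (ht c h)
    refine hC (hasCopy_cycleGraph_of_list (a :: x :: b :: y :: c :: z :: w :: t)
      (by simp at hlen ⊢; omega) (by omega) ?_ ?_ ?_)
    · have h1 : ∀ u ∈ A, a ≠ u := fun u hu h => haA (h ▸ hu)
      have h2 : ∀ u ∈ A, b ≠ u := fun u hu h => hbA (h ▸ hu)
      have h3 : ∀ u ∈ A, c ≠ u := fun u hu h => hcA (h ▸ hu)
      have := h1 x hx; have := h1 y hy; have := h1 z hz; have := h1 w hw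
      have := h2 x hx; have := h2 y hy; have := h2 z hz; have := h2 w hw
      have := h3 x hx; have := h3 y hy; have := h3 z hz; have := h3 w hw
      simp only [List.nodup_cons, List.mem_cons, not_or] at hnd ⊢
      grind
    · simp only [List.isChain_cons_cons]
      exact ⟨ha x hx, (hb x hx).symm, hb y hy, (hc y hy).symm, hc z hz, hch.2.2⟩
    · exact (ha _ hlast).symm

/-- The tuple `f` consists of distinct pairwise nonadjacent vertices. -/
def IsIndepTuple {V ι : Type*} (G : SimpleGraph V) (f : ι → V) : Prop :=
  ∀ i j, i ≠ j → f i ≠ f j ∧ ¬ G.Adj (f i) (f j)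

/-- The number of tuples in `A` with two prescribed entries. -/
lemma card_piFinset_two_fixed {V : Type*} [DecidableEq V] {s : ℕ} (A : Finset V) (i j : Fin s)
    (hij : i ≠ j) (x y : V) :
    #(Fintype.piFinset fun l : Fin s => if l = i then {x} else if l = j then {y} else A) =
      #A ^ (s - 2) := by
  rw [Fintype.card_piFinset]
  have h : ∀ l : Fin s, #(if l = i then {x} else if l = j then {y} else A) =
      if l ∈ ({i, j} : Finset (Fin s)) then 1 else #A := by
    intro l
    by_cases h1 : l = i
    · simp [h1]
    · by_cases h2 : l = j
      · simp [h2, hij.symm]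
      · simp [h1, h2]
  rw [prod_congr rfl fun l _ => h l, prod_ite, prod_const_one, one_mul, prod_const]
  congr 1
  have : ({l | l ∉ ({i, j} : Finset (Fin s))} : Finset (Fin s)) = ({i, j} : Finset (Fin s))ᶜ := by
    ext; simp
  rw [this, card_compl, card_pair hij, Fintype.card_fin]

/-- Most tuples in `A` are independent if `A` spans few edges. -/
lemma card_pow_le_card_indepTuples_add {V : Type*} [DecidableEq V] (G : SimpleGraph V)
    [DecidableRel G.Adj] (s : ℕ) (A : Finset V)
    [DecidablePred fun f : Fin s → V => IsIndepTuple G f] :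
    #A ^ s ≤ #{f ∈ Fintype.piFinset fun _ : Fin s => A | IsIndepTuple G f} +
      s * s * (#{p ∈ A ×ˢ A | p.1 = p.2 ∨ G.Adj p.1 p.2} * #A ^ (s - 2)) := by
  set P := {p ∈ A ×ˢ A | p.1 = p.2 ∨ G.Adj p.1 p.2} with hP
  set U := Fintype.piFinset fun _ : Fin s => A with hU
  have hUc : #U = #A ^ s := by simp [hU]
  have hsub : {f ∈ U | ¬ IsIndepTuple G f} ⊆
      ({q : Fin s × Fin s | q.1 ≠ q.2} : Finset _).biUnion fun q => P.biUnion fun p =>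
        Fintype.piFinset fun l : Fin s =>
          if l = q.1 then {p.1} else if l = q.2 then {p.2} else A := by
    intro f hf
    simp only [mem_filter, IsIndepTuple, not_forall, hU, Fintype.mem_piFinset] at hf
    obtain ⟨hfA, i, j, hij, h⟩ := hf
    simp only [mem_biUnion, mem_filter, mem_univ, true_and]
    refine ⟨(i, j), hij, (f i, f j), ?_, ?_⟩
    · rw [hP, mem_filter, mem_product]
      exact ⟨⟨hfA i, hfA j⟩, by tauto⟩
    · rw [Fintype.mem_piFinset]
      intro l
      by_cases h1 : l = i
      · simp [h1]
      · by_cases h2 : l = j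
        · subst h2; simp [h1]
        · simpa [h1, h2] using hfA l
  have hbad : #{f ∈ U | ¬ IsIndepTuple G f} ≤ s * s * (#P * #A ^ (s - 2)) := by
    refine (card_le_card hsub).trans ((card_biUnion_le_card_mul _ _ (#P * #A ^ (s - 2)) ?_).trans
      (Nat.mul_le_mul_right _ ((card_le_univ _).trans (by simp))))
    intro q hq
    refine card_biUnion_le_card_mul _ _ _ fun p _ => ?_
    exact (card_piFinset_two_fixed A q.1 q.2 (mem_filter.1 hq).2 p.1 p.2).le
  rw [← hUc, ← card_filter_add_card_filter_not (s := U) (fun f => IsIndepTuple G f)]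
  omega

/-- An independent `s`-tuple has few common neighbours. -/
lemma card_common_neighbors_le_s19 {V : Type*} [Fintype V] [LinearOrder V] {G : SimpleGraph V}
    [DecidableRel G.Adj] {k s : ℕ} (hs : 3 ≤ s) (hk : 3 ≤ k)
    (hC : ¬ HasCopy (cycleGraph (2 * k + 1)) G)
    (hK : ¬ HasInducedCopy (completeBipartiteGraph (Fin s) (Fin s)) G)
    (f : Fin s → V) (hf : IsIndepTuple G f) :
    #{v | ∀ i, G.Adj v (f i)} ≤ (2 * k - 3) * (s - 1) := by
  by_contra! hlt
  set A : Finset V := {v | ∀ i, G.Adj v (f i)} with hA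
  have hadj : ∀ i, ∀ x ∈ A, G.Adj (f i) x := fun i x hx => ((mem_filter.1 hx).2 i).symm
  have hfinj : Function.Injective f := fun i j h => by
    by_contra hij
    exact (hf i j hij).1 h
  obtain ⟨l, hl, hlen⟩ := exists_isPathIn_of_card G (s - 1) (2 * k - 3) A (by
    intro B hBA hB
    by_contra! hBs
    obtain ⟨C, hCB, hCs⟩ := exists_subset_card_eq (by omega : s ≤ #B)
    let g : Fin s → V := C.orderEmbOfFin hCs
    have hg : ∀ i, g i ∈ C := fun i => orderEmbOfFin_mem C hCs i
    have hginj : Function.Injective g := (C.orderEmbOfFin hCs).injective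
    have hfg : ∀ i j, G.Adj (f i) (g j) := fun i j => hadj i _ (hBA (hCB (hg j)))
    have hgg : ∀ i j, ¬ G.Adj (g i) (g j) := fun i j h =>
      hB (hCB (hg i)) (hCB (hg j)) h.ne h
    have hff : ∀ i j, ¬ G.Adj (f i) (f j) := fun i j h =>
      (hf i j fun hij => h.ne (congrArg f hij)).2 h
    refine hK ⟨⟨⟨Sum.elim f g, ?_⟩, ?_⟩⟩
    · exact hfinj.sumElim hginj fun i j => (hfg i j).ne
    · rintro (a | a) (b | b) <;>
        simp [completeBipartiteGraph, hfg, hgg, hff, (hfg _ _).symm]) hlt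
  have hne : ∀ i j : Fin s, i ≠ j → f i ≠ f j := fun i j h => hfinj.ne h
  exact length_ne_of_isPathIn_common_neighbors hk hC (f ⟨0, by omega⟩) (f ⟨1, by omega⟩)
    (f ⟨2, by omega⟩) (hne _ _ (by simp)) (hne _ _ (by simp)) (hne _ _ (by simp)) A
    (hadj _) (hadj _) (hadj _) l hl (by omega)

/-- In a `C_{2k+1}`-free graph, at least half of the `s`-tuples of neighbours of a vertex of large
degree are independent. -/
lemma degree_pow_le {V : Type*} [Fintype V] [DecidableEq V] {G : SimpleGraph V}
    [DecidableRel G.Adj] {k s : ℕ} (hs : 2 ≤ s) (hk : 1 ≤ k)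
    (hC : ¬ HasCopy (cycleGraph (2 * k + 1)) G) (v : V)
    [DecidablePred fun f : Fin s → V => IsIndepTuple G f] :
    G.degree v ^ s ≤
      2 * #{f ∈ Fintype.piFinset fun _ : Fin s => G.neighborFinset v | IsIndepTuple G f} +
        (8 * k * (s * s)) ^ s := by
  rcases lt_or_ge (G.degree v) (8 * k * (s * s)) with h | h
  · exact (Nat.pow_le_pow_left h.le s).trans (Nat.le_add_left _ _)
  set A := G.neighborFinset v with hA
  have hAd : #A = G.degree v := G.card_neighborFinset_eq_degree v
  rw [← hAd] at h ⊢
  have hpairs := card_adj_pairs_le G (2 * k - 1) A fun l hl => by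
    rw [Nat.sub_add_cancel (by omega)]
    exact length_ne_of_isPathIn_neighbors hk hC v A (fun x hx => by simpa [hA] using hx) l hl
  have hdiag : #{p ∈ A ×ˢ A | p.1 = p.2 ∨ G.Adj p.1 p.2} ≤ 4 * k * #A := by
    rw [filter_or]
    have h1 : #{p ∈ A ×ˢ A | p.1 = p.2} ≤ #A := by
      refine card_le_card_of_injOn Prod.fst (fun p hp => ?_) fun p hp q hq hpq => ?_
      · exact (mem_product.1 (mem_filter.1 hp).1).1
      · have hp2 := (mem_filter.1 hp).2
        have hq2 := (mem_filter.1 hq).2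
        exact Prod.ext hpq (hp2.symm.trans (hpq.trans hq2))
    have h2 := card_union_le {p ∈ A ×ˢ A | p.1 = p.2} {p ∈ A ×ˢ A | G.Adj p.1 p.2}
    have h3 : 2 * (2 * k - 1) * #A + #A ≤ 4 * k * #A := by
      rw [← Nat.succ_mul]
      exact Nat.mul_le_mul_right _ (by omega)
    omega
  have hmain := card_pow_le_card_indepTuples_add G s A
  obtain ⟨r, rfl⟩ : ∃ r, s = r + 2 := ⟨s - 2, by omega⟩
  have hbad : 2 * ((r + 2) * (r + 2) * (#{p ∈ A ×ˢ A | p.1 = p.2 ∨ G.Adj p.1 p.2} *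
      #A ^ (r + 2 - 2))) ≤ #A ^ (r + 2) := by
    calc _ ≤ 2 * ((r + 2) * (r + 2) * (4 * k * #A * #A ^ r)) := by
          rw [Nat.add_sub_cancel]; gcongr
      _ = 8 * k * ((r + 2) * (r + 2)) * #A ^ (r + 1) := by ring
      _ ≤ #A * #A ^ (r + 1) := Nat.mul_le_mul_right _ h
      _ = _ := by ring
  omega

/-- Double counting of vertices and independent tuples of their neighbours. -/
lemma sum_degree_pow_le {V : Type*} [Fintype V] [LinearOrder V] {G : SimpleGraph V}
    [DecidableRel G.Adj] {k s : ℕ} (hs : 3 ≤ s) (hk : 3 ≤ k)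
    (hC : ¬ HasCopy (cycleGraph (2 * k + 1)) G)
    (hK : ¬ HasInducedCopy (completeBipartiteGraph (Fin s) (Fin s)) G) :
    ∑ v, G.degree v ^ s ≤ 2 * ((2 * k - 3) * (s - 1) * Fintype.card V ^ s) +
      Fintype.card V * (8 * k * (s * s)) ^ s := by
  classical
  have hcount : ∑ v, #{f ∈ Fintype.piFinset fun _ : Fin s => G.neighborFinset v |
      IsIndepTuple G f} ≤ (2 * k - 3) * (s - 1) * Fintype.card V ^ s := by
    have h1 : ∀ v, {f ∈ Fintype.piFinset fun _ : Fin s => G.neighborFinset v |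
        IsIndepTuple G f} = bipartiteAbove (fun v f => ∀ i, G.Adj v (f i))
          ({f | IsIndepTuple G f} : Finset (Fin s → V)) v := by
      intro v
      ext f
      simp [bipartiteAbove, and_comm]
    rw [sum_congr rfl fun v _ => congrArg card (h1 v),
      sum_card_bipartiteAbove_eq_sum_card_bipartiteBelow]
    refine (sum_le_card_nsmul _ _ ((2 * k - 3) * (s - 1)) fun f hf => ?_).trans ?_
    · exact card_common_neighbors_le_s19 hs hk hC hK f (mem_filter.1 hf).2
    · rw [smul_eq_mul, mul_comm]
      exact Nat.mul_le_mul_left _ ((card_le_univ _).trans (by simp))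
  calc ∑ v, G.degree v ^ s ≤ ∑ v, (2 * #{f ∈ Fintype.piFinset fun _ : Fin s =>
        G.neighborFinset v | IsIndepTuple G f} + (8 * k * (s * s)) ^ s) :=
        sum_le_sum fun v _ => degree_pow_le (by omega) (by omega) hC v
    _ ≤ _ := by
        rw [sum_add_distrib, ← mul_sum, sum_const, card_univ, smul_eq_mul]
        gcongr

lemma three_mul_factorial_le {s : ℕ} (hs : 3 ≤ s) : 3 * s.factorial ≤ (2 * 4 ^ s) ^ s := by
  have h1 : s.factorial ≤ (4 ^ s) ^ s :=
    (Nat.factorial_le_pow s).trans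
      (Nat.pow_le_pow_left (Nat.lt_pow_self (by norm_num)).le s)
  have h2 : 3 ≤ 2 ^ s := le_trans (by norm_num) (Nat.pow_le_pow_right (by norm_num) hs)
  rw [mul_pow]
  exact Nat.mul_le_mul h2 h1

/-- For `k ≥ s ≥ 3`, every `n`-vertex graph with no `C_{2k+1}` subgraph and no induced
`K_{s,s}` has at most `(4^s(s−1)^{1/s}(2k−3)^{1/s}/(s!)^{1/s})·n^{2−1/s} + o(n^{2−1/s})`
edges. -/
theorem stmt19 (k s : ℕ) (hs : 3 ≤ s) (hk : s ≤ k) :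
    ∀ ε > (0 : ℝ), ∃ N : ℕ, ∀ n ≥ N, ∀ (G : SimpleGraph (Fin n)) [DecidableRel G.Adj],
      ¬ HasCopy (cycleGraph (2 * k + 1)) G →
      ¬ HasInducedCopy (completeBipartiteGraph (Fin s) (Fin s)) G →
      (G.edgeFinset.card : ℝ) ≤
        (4 ^ s * ((s : ℝ) - 1) ^ ((1 : ℝ) / s) * ((2 * k : ℝ) - 3) ^ ((1 : ℝ) / s) /
            ((s.factorial : ℝ)) ^ ((1 : ℝ) / s)) * (n : ℝ) ^ ((2 : ℝ) - 1 / s) +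
          ε * (n : ℝ) ^ ((2 : ℝ) - 1 / s) := by
  intro ε hε
  refine ⟨(8 * k * (s * s)) ^ s + 1, fun n hn G _ hC hK => ?_⟩
  refine le_add_of_le_of_nonneg ?_ (by positivity)
  have hdeg := sum_degree_pow_le hs (hs.trans hk) hC hK
  rw [Fintype.card_fin] at hdeg
  have hlow : n * (8 * k * (s * s)) ^ s ≤ (2 * k - 3) * (s - 1) * n ^ s := by
    calc n * (8 * k * (s * s)) ^ s ≤ n * n := Nat.mul_le_mul_left _ (by omega)
      _ = n ^ 2 := (sq n).symm
      _ ≤ n ^ s := Nat.pow_le_pow_right (by omega) (by omega)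
      _ ≤ _ := Nat.le_mul_of_pos_left _ (Nat.mul_pos (by omega) (by omega))
  have hpow : (2 * #G.edgeFinset) ^ s ≤ n ^ (s - 1) * ∑ v, G.degree v ^ s := by
    rw [← G.sum_degrees_eq_twice_card_edges]
    obtain ⟨r, rfl⟩ : ∃ r, s = r + 1 := ⟨s - 1, by omega⟩
    simpa using pow_sum_le_card_mul_sum_pow (s := (univ : Finset (Fin n)))
      (f := fun v => G.degree v) (fun _ _ => Nat.zero_le _) r
  have hnat : s.factorial * (2 * #G.edgeFinset) ^ s ≤
      (2 * 4 ^ s) ^ s * ((s - 1) * (2 * k - 3)) * n ^ (2 * s - 1) := by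
    calc _ ≤ s.factorial * (n ^ (s - 1) * (3 * ((2 * k - 3) * (s - 1) * n ^ s))) :=
          Nat.mul_le_mul_left _ (hpow.trans (Nat.mul_le_mul_left _ (by omega)))
      _ = (3 * s.factorial) * ((s - 1) * (2 * k - 3)) * (n ^ (s - 1) * n ^ s) := by ring
      _ ≤ _ := by
        rw [← pow_add, (by omega : s - 1 + s = 2 * s - 1)]
        gcongr
        exact three_mul_factorial_le hs
  have hreal : (s.factorial : ℝ) * #G.edgeFinset ^ s ≤
      (4 ^ s) ^ s * (((s : ℝ) - 1) * (2 * k - 3)) * (n : ℝ) ^ (2 * s - 1) := by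
    have h := (Nat.cast_le (α := ℝ)).2 hnat
    push_cast [Nat.cast_sub (by omega : 1 ≤ s), Nat.cast_sub (by omega : 3 ≤ 2 * k)] at h
    rw [mul_pow, mul_pow] at h
    refine le_of_mul_le_mul_left ?_ (by positivity : (0 : ℝ) < 2 ^ s)
    linarith
  have hs0 : s ≠ 0 := by omega
  have hs1 : (0 : ℝ) ≤ (s : ℝ) - 1 := by
    have : (3 : ℝ) ≤ s := by exact_mod_cast hs
    linarith
  have hk1 : (0 : ℝ) ≤ 2 * (k : ℝ) - 3 := by
    have : (3 : ℝ) ≤ k := by exact_mod_cast hs.trans hk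
    linarith
  have hroot : ∀ x : ℝ, 0 ≤ x → (x ^ ((1 : ℝ) / s)) ^ s = x := fun x hx => by
    rw [one_div, Real.rpow_inv_natCast_pow hx hs0]
  have hnexp : ((n : ℝ) ^ ((2 : ℝ) - 1 / s)) ^ s = (n : ℝ) ^ (2 * s - 1) := by
    rw [← Real.rpow_mul_natCast (Nat.cast_nonneg n), ← Real.rpow_natCast]
    congr 1
    have : (s : ℝ) ≠ 0 := by exact_mod_cast hs0
    push_cast [Nat.cast_sub (by omega : 1 ≤ 2 * s)]
    field_simp
  refine le_of_pow_le_pow_left₀ hs0 (by positivity) ?_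
  rw [mul_pow, div_pow, mul_pow, mul_pow, hroot _ hs1, hroot _ hk1, hroot _ (by positivity), hnexp,
    div_mul_eq_mul_div, le_div_iff₀ (by positivity)]
  linarith
end
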